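/- Let I = (L(u,v)) be any lexsegment edge ideal in S = k[x_1,...,x_n]. Then the arithmetical rank of I equals the projective dimension of S/I: ara(I) = pd_S(S/I). -/

import Mathlib

open MvPolynomial

variable {k : Type*} [Field k]

/-- The squarefree monomial `x_F = ∏_{i ∈ F} x_i`. -/
noncomputable def sqMon (n : ℕ) (k : Type*) [Field k] (F : Finset (Fin n)) :
    MvPolynomial (Fin n) k :=
  ∏ i ∈ F, X i

/-- `x_F >_lex x_G` for squarefree monomials: at the smallest index where the supports
differ, the index belongs to `F`. -/
def sqGtLex {n : ℕ} (F G : Finset (Fin n)) : Prop :=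
  ∃ a, a ∈ F ∧ a ∉ G ∧ ∀ b, b < a → (b ∈ F ↔ b ∈ G)

/-- `x_F ≥_lex x_G` for squarefree monomials. -/
def sqGeLex {n : ℕ} (F G : Finset (Fin n)) : Prop :=
  F = G ∨ sqGtLex F G

/-- The squarefree lexsegment set `L(u,v)` of degree `q` (as a set of supports). -/
def sqLexSeg {n : ℕ} (q : ℕ) (u v : Finset (Fin n)) : Set (Finset (Fin n)) :=
  {w | w.card = q ∧ sqGeLex u w ∧ sqGeLex w v}

/-- The initial squarefree lexsegment set `L^i(v)` of degree `q`. -/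
def sqLexSegInit {n : ℕ} (q : ℕ) (v : Finset (Fin n)) : Set (Finset (Fin n)) :=
  {w | w.card = q ∧ sqGeLex w v}

/-- The final squarefree lexsegment set `L^f(u)` of degree `q`. -/
def sqLexSegFinal {n : ℕ} (q : ℕ) (u : Finset (Fin n)) : Set (Finset (Fin n)) :=
  {w | w.card = q ∧ sqGeLex u w}

/-- The squarefree monomial ideal generated by a set of supports. -/
noncomputable def sqIdeal (n : ℕ) (k : Type*) [Field k] (L : Set (Finset (Fin n))) :
    Ideal (MvPolynomial (Fin n) k) :=
  Ideal.span ((fun F => sqMon n k F) '' L)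

/-- The monomial prime ideal `P_G` generated by the variables indexed by `G`. -/
noncomputable def varIdeal (n : ℕ) (k : Type*) [Field k] (G : Finset (Fin n)) :
    Ideal (MvPolynomial (Fin n) k) :=
  Ideal.span ((fun i => (X i : MvPolynomial (Fin n) k)) '' (G : Set (Fin n)))

/-- The depth of `S/I`: the supremum of lengths of regular sequences on `S/I`
contained in the graded maximal ideal `(x_1, ..., x_n)`. -/
noncomputable def depthQ {n : ℕ} {k : Type*} [Field k]
    (I : Ideal (MvPolynomial (Fin n) k)) : ℕ :=
  sSup {r | ∃ rs : List (MvPolynomial (Fin n) k), rs.length = r ∧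
    (∀ x ∈ rs, x ∈ Ideal.span (Set.range (X : Fin n → MvPolynomial (Fin n) k))) ∧
    RingTheory.Sequence.IsRegular (MvPolynomial (Fin n) k ⧸ I) rs}

/-- A face of the Stanley–Reisner complex of the squarefree monomial ideal `I`. -/
def isFace {n : ℕ} (k : Type*) [Field k] (I : Ideal (MvPolynomial (Fin n) k))
    (F : Finset (Fin n)) : Prop :=
  sqMon n k F ∉ I

/-- A facet (maximal face) of the Stanley–Reisner complex of `I`. -/
def isFacet {n : ℕ} (k : Type*) [Field k] (I : Ideal (MvPolynomial (Fin n) k))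
    (F : Finset (Fin n)) : Prop :=
  isFace k I F ∧ ∀ G, F ⊂ G → ¬ isFace k I G
/-- The arithmetical rank of an ideal: the least number of elements of `I` generating an
ideal with the same radical as `I`. -/
noncomputable def araI {n : ℕ} {k : Type*} [Field k]
    (I : Ideal (MvPolynomial (Fin n) k)) : ℕ :=
  sInf {m | ∃ f : Fin m → MvPolynomial (Fin n) k, (∀ t, f t ∈ I) ∧
    (Ideal.span (Set.range f)).radical = I.radical}

/-- `PdBound I p` holds if `S/I` admits a finite free resolution
`0 → F_p → ... → F_1 → F_0 → S/I → 0` of length at most `p`. -/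
def PdBound {n : ℕ} {k : Type*} [Field k] (I : Ideal (MvPolynomial (Fin n) k))
    (p : ℕ) : Prop :=
  ∃ (ι : ℕ → Type) (_ : ∀ m, Fintype (ι m))
    (f : ∀ m, ((ι (m + 1)) →₀ MvPolynomial (Fin n) k) →ₗ[MvPolynomial (Fin n) k]
      ((ι m) →₀ MvPolynomial (Fin n) k))
    (g : ((ι 0) →₀ MvPolynomial (Fin n) k) →ₗ[MvPolynomial (Fin n) k]
      (MvPolynomial (Fin n) k ⧸ I)),
    Function.Surjective g ∧
    LinearMap.range (f 0) = LinearMap.ker g ∧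
    (∀ m, LinearMap.range (f (m + 1)) = LinearMap.ker (f m)) ∧
    (∀ m, p < m → IsEmpty (ι m))

/-- The projective dimension of `S/I`, as the least length of a finite free resolution
of `S/I` (over the polynomial ring, this coincides with the projective dimension). -/
noncomputable def pdQ {n : ℕ} {k : Type*} [Field k]
    (I : Ideal (MvPolynomial (Fin n) k)) : ℕ :=
  sInf {p | PdBound I p}


universe u


/-- An injective resolution of the ring `R` as a module over itself. -/
structure InjRes (R : Type u) [CommRing R] where
  E : ℕ → Type u
  [ag : ∀ i, AddCommGroup (E i)]
  [md : ∀ i, Module R (E i)]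
  d : ∀ i, E i →ₗ[R] E (i + 1)
  eta : R →ₗ[R] E 0
  baer : ∀ i, Module.Baer R (E i)
  eta_inj : Function.Injective eta
  d_eta : ∀ x, d 0 (eta x) = 0
  ker_zero : ∀ e, d 0 e = 0 → ∃ x, eta x = e
  dd : ∀ i e, d (i + 1) (d i e) = 0
  exact : ∀ i e, d (i + 1) e = 0 → ∃ w, d i w = e

attribute [instance] InjRes.ag InjRes.md

section InjResExists
variable (R : Type u) [CommRing R]

theorem exists_baer_embedding (M : Type u) [AddCommGroup M] [Module R M] :
    ∃ (E : Type u) (_ : AddCommGroup E) (_ : Module R E) (f : M →ₗ[R] E),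
      Module.Baer R E ∧ Function.Injective f := by
  let X := CategoryTheory.Injective.under (ModuleCat.of R M)
  refine ⟨X, inferInstance, inferInstance, (CategoryTheory.Injective.ι (ModuleCat.of R M)).hom,
    ?_, ?_⟩
  · apply Module.Baer.of_injective
    have : CategoryTheory.Injective X := CategoryTheory.Injective.injective_under _
    exact Module.injective_module_of_injective_object (M := X) (inj := this)
  · exact (ModuleCat.mono_iff_injective _).1 inferInstance

/-- An injective module containing `M`. -/
noncomputable def Hull (M : Type u) [AddCommGroup M] [Module R M] : Type u :=
  (exists_baer_embedding R M).choose

noncomputable instance (M : Type u) [AddCommGroup M] [Module R M] : AddCommGroup (Hull R M) :=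
  (exists_baer_embedding R M).choose_spec.choose

noncomputable instance (M : Type u) [AddCommGroup M] [Module R M] : Module R (Hull R M) :=
  (exists_baer_embedding R M).choose_spec.choose_spec.choose

/-- The embedding of `M` in its injective module. -/
noncomputable def hullι (M : Type u) [AddCommGroup M] [Module R M] : M →ₗ[R] Hull R M :=
  (exists_baer_embedding R M).choose_spec.choose_spec.choose_spec.choose

theorem hull_baer (M : Type u) [AddCommGroup M] [Module R M] : Module.Baer R (Hull R M) :=
  (exists_baer_embedding R M).choose_spec.choose_spec.choose_spec.choose_spec.1

theorem hull_inj (M : Type u) [AddCommGroup M] [Module R M] : Function.Injective (hullι R M) :=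
  (exists_baer_embedding R M).choose_spec.choose_spec.choose_spec.choose_spec.2

/-- The cosyzygy. -/
abbrev Cosyz (M : Type u) [AddCommGroup M] [Module R M] : Type u :=
  Hull R M ⧸ LinearMap.range (hullι R M)

/-- The differential. -/
noncomputable def hullD (M : Type u) [AddCommGroup M] [Module R M] :
    Hull R M →ₗ[R] Hull R (Cosyz R M) :=
  hullι R (Cosyz R M) ∘ₗ (LinearMap.range (hullι R M)).mkQ

theorem hullD_ker (M : Type u) [AddCommGroup M] [Module R M] (e : Hull R M) :
    hullD R M e = 0 ↔ ∃ x, hullι R M x = e := by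
  rw [hullD, LinearMap.comp_apply, map_eq_zero_iff _ (hull_inj R _), Submodule.mkQ_apply,
    Submodule.Quotient.mk_eq_zero, LinearMap.mem_range]

theorem hullD_range (M : Type u) [AddCommGroup M] [Module R M] (e : Hull R (Cosyz R M)) :
    (∃ x, hullι R (Cosyz R M) x = e) ↔ ∃ w, hullD R M w = e := by
  constructor
  · rintro ⟨x, rfl⟩
    obtain ⟨w, rfl⟩ := Submodule.mkQ_surjective (LinearMap.range (hullι R M)) x
    exact ⟨w, rfl⟩
  · rintro ⟨w, rfl⟩
    exact ⟨(LinearMap.range (hullι R M)).mkQ w, rfl⟩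

/-- The iterated cosyzygies. -/
noncomputable def cosyz : ℕ → ModuleCat.{u} R
  | 0 => ModuleCat.of R R
  | i + 1 => ModuleCat.of R (Cosyz R (cosyz i))

/-- Injective resolutions exist. -/
noncomputable def injRes : InjRes R where
  E i := Hull R (cosyz R i)
  d i := hullD R (cosyz R i)
  eta := hullι R R
  baer i := hull_baer R _
  eta_inj := hull_inj R R
  d_eta x := (hullD_ker R (cosyz R 0) _).2 ⟨x, rfl⟩
  ker_zero e h := (hullD_ker R (cosyz R 0) e).1 h
  dd i e := (hullD_ker R (cosyz R (i + 1)) _).2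
    ((hullD_range R (cosyz R i) _).2 ⟨e, rfl⟩)
  exact i e h := (hullD_range R (cosyz R i) e).1 ((hullD_ker R (cosyz R (i + 1)) e).1 h)

end InjResExists

section Gam
variable {R : Type u} [CommRing R]

/-- elements killed by `J`. -/
def Ann (J : Ideal R) (M : Type*) [AddCommGroup M] [Module R M] : Submodule R M where
  carrier := {e | ∀ a ∈ J, a • e = 0}
  add_mem' := by
    intro x y hx hy a ha
    rw [smul_add, hx a ha, hy a ha, add_zero]
  zero_mem' := by intro a _; simp
  smul_mem' := by
    intro c x hx a ha
    rw [smul_comm, hx a ha, smul_zero]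

/-- elements killed by a power of `J`. -/
def Gam (J : Ideal R) (M : Type*) [AddCommGroup M] [Module R M] : Submodule R M where
  carrier := {e | ∃ t, ∀ a ∈ J ^ t, a • e = 0}
  add_mem' := by
    rintro x y ⟨s, hs⟩ ⟨t, ht⟩
    refine ⟨max s t, fun a ha => ?_⟩
    rw [smul_add, hs a (Ideal.pow_le_pow_right (le_max_left _ _) ha),
      ht a (Ideal.pow_le_pow_right (le_max_right _ _) ha), add_zero]
  zero_mem' := ⟨0, by intro a _; simp⟩
  smul_mem' := by
    rintro c x ⟨t, ht⟩
    refine ⟨t, fun a ha => ?_⟩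
    rw [smul_comm, ht a ha, smul_zero]

variable {M N : Type*} [AddCommGroup M] [Module R M] [AddCommGroup N] [Module R N]

theorem mem_Ann {J : Ideal R} {e : M} : e ∈ Ann J M ↔ ∀ a ∈ J, a • e = 0 := Iff.rfl

theorem mem_Gam {J : Ideal R} {e : M} : e ∈ Gam J M ↔ ∃ t, ∀ a ∈ J ^ t, a • e = 0 := Iff.rfl

theorem Ann_le_Gam (J : Ideal R) : Ann J M ≤ Gam J M := by
  intro e he
  exact ⟨1, by rw [pow_one]; exact he⟩

theorem Ann_anti {J K : Ideal R} (h : J ≤ K) : Ann K M ≤ Ann J M :=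
  fun _ he a ha => he a (h ha)

theorem Gam_anti {J K : Ideal R} (h : J ≤ K) : Gam K M ≤ Gam J M := by
  rintro e ⟨t, ht⟩
  exact ⟨t, fun a ha => ht a (Ideal.pow_right_mono h t ha)⟩

theorem Ann_map (f : M →ₗ[R] N) {J : Ideal R} {e : M} (he : e ∈ Ann J M) : f e ∈ Ann J N := by
  intro a ha
  rw [← map_smul, he a ha, map_zero]

theorem Gam_map (f : M →ₗ[R] N) {J : Ideal R} {e : M} (he : e ∈ Gam J M) : f e ∈ Gam J N := by
  obtain ⟨t, ht⟩ := he
  exact ⟨t, fun a ha => by rw [← map_smul, ht a ha, map_zero]⟩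

theorem Gam_pow {J K : Ideal R} {m : ℕ} (h : K ^ m ≤ J) : Gam J M ≤ Gam K M := by
  rintro e ⟨t, ht⟩
  refine ⟨m * t, fun a ha => ht a ?_⟩
  rw [pow_mul] at ha
  exact Ideal.pow_right_mono h t ha

theorem Gam_radical [IsNoetherianRing R] {J K : Ideal R} (h : K ≤ J.radical) :
    Gam J M ≤ Gam K M := by
  obtain ⟨m, hm⟩ := Ideal.exists_pow_le_of_le_radical_of_fg h (IsNoetherian.noetherian K)
  exact Gam_pow hm

theorem Gam_sup {J K : Ideal R} {e : M} (h1 : e ∈ Gam J M) (h2 : e ∈ Gam K M) :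
    e ∈ Gam (J ⊔ K) M := by
  obtain ⟨s, hs⟩ := h1
  obtain ⟨t, ht⟩ := h2
  refine ⟨s + t, fun a ha => ?_⟩
  have := Ideal.sup_pow_add_le_pow_sup_pow (I := J) (J := K) (n := s) (m := t) ha
  obtain ⟨b, hb, c, hc, rfl⟩ := Submodule.mem_sup.1 this
  rw [add_smul, hs b hb, ht c hc, add_zero]

theorem mem_Gam_span_singleton {g : R} {e : M} :
    e ∈ Gam (Ideal.span {g}) M ↔ ∃ t, g ^ t • e = 0 := by
  rw [mem_Gam]
  refine exists_congr fun t => ?_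
  rw [Ideal.span_singleton_pow]
  constructor
  · intro h
    exact h _ (Ideal.mem_span_singleton_self _)
  · intro h a ha
    obtain ⟨c, rfl⟩ := Ideal.mem_span_singleton'.1 ha
    rw [mul_smul, h, smul_zero]

/-- Extension of maps in an injective module. -/
theorem baer_extend {Q : Type*} [AddCommGroup Q] [Module R Q] (hQ : Module.Baer R Q)
    (α : M →ₗ[R] N) (f : M →ₗ[R] Q) (h : ∀ x, α x = 0 → f x = 0) :
    ∃ g : N →ₗ[R] Q, ∀ x, g (α x) = f x := by
  let f' : (M ⧸ LinearMap.ker α) →ₗ[R] Q := (LinearMap.ker α).liftQ f (fun x hx => h x hx)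
  let α' : (M ⧸ LinearMap.ker α) →ₗ[R] N := (LinearMap.ker α).liftQ α le_rfl
  obtain ⟨g, hg⟩ := hQ.extension_property α'
    (by rw [← LinearMap.ker_eq_bot]; exact Submodule.ker_liftQ_eq_bot' _ _ rfl) f'
  refine ⟨g, fun x => ?_⟩
  have := LinearMap.congr_fun hg (Submodule.Quotient.mk x)
  exact this

/-- Division in an injective module. -/
theorem baer_divide (hM : Module.Baer R M) (K : Ideal R) (y : R) (z : M)
    (h : ∀ s, y * s ∈ K → s • z = 0) : ∃ w ∈ Ann K M, y • w = z := by
  obtain ⟨g, hg⟩ := baer_extend hM (LinearMap.lsmul R (R ⧸ K) y ∘ₗ K.mkQ)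
    (LinearMap.toSpanSingleton R M z) (by
      intro x hx
      apply h
      have : Submodule.Quotient.mk (p := K) (y * x) = 0 := by
        exact hx
      exact (Submodule.Quotient.mk_eq_zero K).1 this)
  refine ⟨g (K.mkQ 1), ?_, ?_⟩
  · intro a ha
    rw [← map_smul, ← map_smul]
    have : K.mkQ (a • 1) = 0 := by
      rw [Submodule.mkQ_apply, Submodule.Quotient.mk_eq_zero]; simpa using ha
    rw [this, map_zero]
  · have := hg 1
    simp only [LinearMap.comp_apply, LinearMap.lsmul_apply, map_smul,
      LinearMap.toSpanSingleton_apply, one_smul] at this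
    exact this

theorem baer_split (hM : Module.Baer R M) (P Q : Ideal R) (w : M)
    (h : w ∈ Ann (P ⊓ Q) M) : ∃ p ∈ Ann P M, ∃ q ∈ Ann Q M, w = p + q := by
  obtain ⟨g, hg⟩ := baer_extend hM (P.mkQ.prod Q.mkQ)
    (LinearMap.toSpanSingleton R M w) (by
      intro x hx
      apply h
      have h1 := congrArg Prod.fst hx
      have h2 := congrArg Prod.snd hx
      exact ⟨(Submodule.Quotient.mk_eq_zero P).1 h1, (Submodule.Quotient.mk_eq_zero Q).1 h2⟩)
  refine ⟨g (P.mkQ 1, 0), ?_, g (0, Q.mkQ 1), ?_, ?_⟩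
  · intro a ha
    rw [← map_smul]
    have : P.mkQ (a • 1) = 0 := by
      rw [Submodule.mkQ_apply, Submodule.Quotient.mk_eq_zero]; simpa using ha
    rw [Prod.smul_mk, ← map_smul, this, smul_zero]
    exact map_zero g
  · intro a ha
    rw [← map_smul]
    have : Q.mkQ (a • 1) = 0 := by
      rw [Submodule.mkQ_apply, Submodule.Quotient.mk_eq_zero]; simpa using ha
    rw [Prod.smul_mk, ← map_smul, this, smul_zero]
    exact map_zero g
  · rw [← map_add]
    have := hg 1
    simp only [LinearMap.toSpanSingleton_apply, one_smul] at this
    rw [← this]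
    simp

variable [IsNoetherianRing R]

/-- torsion in an injective module is divisible -/
theorem baer_divide_Gam [IsDomain R] (hM : Module.Baer R M) (J : Ideal R) (y : R) (hy : y ≠ 0)
    (z : M) (hz : z ∈ Gam J M) : ∃ w ∈ Gam J M, y • w = z := by
  obtain ⟨t, ht⟩ := hz
  obtain ⟨c, hc⟩ := Ideal.exists_pow_inf_eq_pow_smul J (Ideal.span {y} : Submodule R R)
  have key := hc (t + c) (by omega)
  obtain ⟨w, hw, hyw⟩ := baer_divide hM (J ^ (t + c)) y z (by
    intro s hs
    apply ht
    have h1 : y * s ∈ (J ^ (t + c) • ⊤ ⊓ Ideal.span {y} : Submodule R R) := by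
      refine ⟨?_, Ideal.mul_mem_right _ _ (Ideal.mem_span_singleton_self y)⟩
      simpa using hs
    rw [key, show t + c - c = t by omega] at h1
    have h2 : y * s ∈ (J ^ t • Ideal.span {y} : Submodule R R) :=
      (Submodule.smul_mono le_rfl inf_le_right) h1
    rw [smul_eq_mul, mul_comm, Ideal.mem_span_singleton_mul] at h2
    obtain ⟨s', hs', he⟩ := h2
    rwa [← mul_left_cancel₀ hy he])
  exact ⟨w, ⟨_, hw⟩, hyw⟩

theorem baer_split_Gam (hM : Module.Baer R M) (P Q I : Ideal R) (hI : P ⊓ Q ≤ I) (w : M)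
    (h : w ∈ Gam I M) : ∃ p ∈ Gam P M, ∃ q ∈ Gam Q M, w = p + q := by
  obtain ⟨t, ht⟩ := h
  obtain ⟨c, hc⟩ := Ideal.exists_pow_inf_eq_pow_smul P (Q ^ t : Submodule R R)
  have key := hc (t + c) (by omega)
  obtain ⟨p, hp, q, hq, e⟩ := baer_split hM (P ^ (t + c)) (Q ^ t) w (by
    intro a ha
    apply ht
    have h1 : a ∈ (P ^ (t + c) • ⊤ ⊓ Q ^ t : Submodule R R) := by
      refine ⟨?_, ha.2⟩
      simpa using ha.1
    rw [key, show t + c - c = t by omega] at h1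
    have h2 : a ∈ (P ^ t • Q ^ t : Submodule R R) :=
      (Submodule.smul_mono le_rfl inf_le_right) h1
    rw [smul_eq_mul, ← mul_pow] at h2
    exact Ideal.pow_right_mono (Ideal.mul_le_inf.trans hI) t h2)
  exact ⟨p, ⟨_, hp⟩, q, ⟨_, hq⟩, e⟩

end Gam

section Exactness
variable {R : Type u} [CommRing R]

/-- `J`-torsion of the resolution is exact in degrees `> p`. -/
def ExG (C : InjRes R) (J : Ideal R) (p : ℕ) : Prop :=
  ∀ i, p ≤ i → ∀ z ∈ Gam J (C.E (i + 1)), C.d (i + 1) z = 0 → ∃ w ∈ Gam J (C.E i), C.d i w = z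

/-- The part of the resolution killed by `J` is exact in degrees `> p`. -/
def ExA (C : InjRes R) (J : Ideal R) (p : ℕ) : Prop :=
  ∀ i, p ≤ i → ∀ z ∈ Ann J (C.E (i + 1)), C.d (i + 1) z = 0 → ∃ w ∈ Ann J (C.E i), C.d i w = z

theorem ExG_bot (C : InjRes R) : ExG C ⊥ 0 := by
  intro i _ z _ hz
  obtain ⟨w, hw⟩ := C.exact i z hz
  exact ⟨w, ⟨1, by intro a ha; rw [pow_one, Ideal.mem_bot] at ha; rw [ha, zero_smul]⟩, hw⟩

theorem ExG_mono {C : InjRes R} {J : Ideal R} {p q : ℕ} (h : p ≤ q) (H : ExG C J p) : ExG C J q :=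
  fun i hi => H i (h.trans hi)

theorem ExG_step [IsNoetherianRing R] [IsDomain R] {C : InjRes R} {J : Ideal R} {p : ℕ} (g : R)
    (H : ExG C J p) : ExG C (J ⊔ Ideal.span {g}) (p + 1) := by
  by_cases hg : g = 0
  · subst hg
    simpa using ExG_mono (Nat.le_succ p) H
  intro i hi z hz hdz
  obtain ⟨i, rfl⟩ : ∃ j, i = j + 1 := ⟨i - 1, by omega⟩
  obtain ⟨w, hw, hdw⟩ := H (i + 1) (by omega) z (Gam_anti le_sup_left hz) hdz
  obtain ⟨t, ht⟩ := mem_Gam_span_singleton.1 (Gam_anti (le_sup_right (a := J)) hz)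
  obtain ⟨v, hv, hdv⟩ := H i (by omega) (g ^ t • w) (Submodule.smul_mem _ _ hw)
    (by rw [map_smul, hdw, ht])
  obtain ⟨v', hv', hgv⟩ := baer_divide_Gam (C.baer i) J (g ^ t) (pow_ne_zero _ hg) v hv
  refine ⟨w - C.d i v', Gam_sup (Submodule.sub_mem _ hw (Gam_map _ hv'))
    (mem_Gam_span_singleton.2 ⟨t, ?_⟩), ?_⟩
  · rw [smul_sub, ← map_smul, hgv, hdv, sub_self]
  · rw [map_sub, C.dd, sub_zero, hdw]

theorem ExG_list [IsNoetherianRing R] [IsDomain R] (C : InjRes R) (l : List R) :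
    ExG C (Ideal.span {x | x ∈ l}) l.length := by
  induction l with
  | nil => simpa using ExG_bot C
  | cons a l ih =>
    have : {x | x ∈ a :: l} = {x | x ∈ l} ∪ {a} := by
      ext x; simp [or_comm]
    rw [this, Ideal.span_union]
    exact ExG_step a ih

theorem ExG_of_ara [IsNoetherianRing R] [IsDomain R] (C : InjRes R) (I : Ideal R) {m : ℕ}
    (f : Fin m → R) (h : (Ideal.span (Set.range f)).radical = I.radical) : ExG C I m := by
  have h1 := ExG_list C (List.ofFn f)
  rw [List.length_ofFn] at h1
  have h2 : {x | x ∈ List.ofFn f} = Set.range f := by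
    ext x; simp [List.mem_ofFn]
  rw [h2] at h1
  intro i hi z hz hdz
  obtain ⟨w, hw, hdw⟩ := h1 i hi z (Gam_radical (by rw [← h]; exact Ideal.le_radical) hz) hdz
  exact ⟨w, Gam_radical (by rw [h]; exact Ideal.le_radical) hw, hdw⟩

/-- Mayer–Vietoris, torsion version. -/
theorem mv_Gam [IsNoetherianRing R] {C : InjRes R} {P Q I : Ideal R} (hP : I ≤ P) (hQ : I ≤ Q)
    (hI : P ⊓ Q ≤ I) {m : ℕ} (eP : ExG C P (m + 1)) (eQ : ExG C Q (m + 1)) (eI : ExG C I m)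
    (z : C.E (m + 2)) (hz : z ∈ Gam (P ⊔ Q) (C.E (m + 2))) (hdz : C.d _ z = 0) :
    ∃ w ∈ Gam (P ⊔ Q) (C.E (m + 1)), C.d _ w = z := by
  obtain ⟨p, hp, hdp⟩ := eP (m + 1) le_rfl z (Gam_anti le_sup_left hz) hdz
  obtain ⟨q, hq, hdq⟩ := eQ (m + 1) le_rfl z (Gam_anti le_sup_right hz) hdz
  obtain ⟨w, hw, hdw⟩ := eI m le_rfl (p - q) (Submodule.sub_mem _ (Gam_anti hP hp)
    (Gam_anti hQ hq)) (by rw [map_sub, hdp, hdq, sub_self])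
  obtain ⟨a, ha, b, hb, rfl⟩ := baer_split_Gam (C.baer m) P Q I hI w hw
  refine ⟨p - C.d m a, Gam_sup (Submodule.sub_mem _ hp (Gam_map _ ha)) ?_, ?_⟩
  · have : p - C.d m a = q + C.d m b := by
      rw [map_add] at hdw
      rw [sub_eq_iff_eq_add, add_assoc, add_comm (C.d m b), hdw]; abel
    rw [this]
    exact Submodule.add_mem _ hq (Gam_map _ hb)
  · rw [map_sub, C.dd, sub_zero, hdp]

/-- Mayer–Vietoris, annihilator version. -/
theorem mv_Ann {C : InjRes R} {P Q I : Ideal R} (hP : I ≤ P) (hQ : I ≤ Q)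
    (hI : P ⊓ Q ≤ I) {m : ℕ} (eP : ExA C P (m + 1)) (eQ : ExA C Q (m + 1)) (eI : ExA C I m)
    (z : C.E (m + 2)) (hz : z ∈ Ann (P ⊔ Q) (C.E (m + 2))) (hdz : C.d _ z = 0) :
    ∃ w ∈ Gam (P ⊔ Q) (C.E (m + 1)), C.d _ w = z := by
  obtain ⟨p, hp, hdp⟩ := eP (m + 1) le_rfl z (Ann_anti le_sup_left hz) hdz
  obtain ⟨q, hq, hdq⟩ := eQ (m + 1) le_rfl z (Ann_anti le_sup_right hz) hdz
  obtain ⟨w, hw, hdw⟩ := eI m le_rfl (p - q) (Submodule.sub_mem _ (Ann_anti hP hp)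
    (Ann_anti hQ hq)) (by rw [map_sub, hdp, hdq, sub_self])
  obtain ⟨a, ha, b, hb, rfl⟩ := baer_split (C.baer m) P Q w (Ann_anti hI hw)
  refine ⟨p - C.d m a, Gam_sup (Submodule.sub_mem _ (Ann_le_Gam _ hp)
    (Gam_map _ (Ann_le_Gam _ ha))) ?_, ?_⟩
  · have : p - C.d m a = q + C.d m b := by
      rw [map_add] at hdw
      rw [sub_eq_iff_eq_add, add_assoc, add_comm (C.d m b), hdw]; abel
    rw [this]
    exact Submodule.add_mem _ (Ann_le_Gam _ hq) (Gam_map _ (Ann_le_Gam _ hb))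
  · rw [map_sub, C.dd, sub_zero, hdp]

/-- Torsion cocycles. -/
def Zc (C : InjRes R) (J : Ideal R) (i : ℕ) : Submodule R (C.E i) :=
  Gam J (C.E i) ⊓ LinearMap.ker (C.d i)

/-- The ideal generated by the powers of the elements of a list. -/
def powId (l : List R) (N : ℕ) : Ideal R := Ideal.span ((fun x => x ^ (N + 1)) '' {x | x ∈ l})

/-- Nondegeneracy of a cocycle along a list of elements. -/
def GoodN (C : InjRes R) (G : Set R) (l : List R) (J : Ideal R) (i : ℕ) (z : C.E i) : Prop :=
  ∀ g ∈ G, ∀ N, (g * l.prod ^ N) • z ∉ powId l N • Zc C J i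

theorem good_step [IsNoetherianRing R] {C : InjRes R} {G : Set R} {l : List R} {y : R}
    {J : Ideal R} {i : ℕ} {z w : C.E i} (hw : w ∈ Gam J (C.E i)) (hyw : y • w = z)
    (hG : GoodN C G (y :: l) J i z) (hE : ExG C J i) :
    ∀ g ∈ G, ∀ N, ∀ b ∈ Gam (J ⊔ Ideal.span {y}) (C.E i),
      (g * l.prod ^ N) • C.d i w - C.d i b ∉ powId l N • Zc C (J ⊔ Ideal.span {y}) (i + 1) := by
  intro g hg N b hb hmem
  have claim : ∀ c ∈ powId l N • Zc C (J ⊔ Ideal.span {y}) (i + 1),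
      ∃ e ∈ Gam J (C.E i), C.d i e = c ∧ ∃ M, ∀ M', M ≤ M' → y ^ M' • e ∈ powId l N • Zc C J i := by
    intro c hc
    refine Submodule.smul_induction_on hc ?_ ?_
    · rintro r hr c ⟨hc1, hc2⟩
      obtain ⟨e, he, hde⟩ := hE i le_rfl c (Gam_anti le_sup_left hc1) hc2
      obtain ⟨M, hM⟩ := mem_Gam_span_singleton.1 (Gam_anti (le_sup_right (a := J)) hc1)
      refine ⟨r • e, Submodule.smul_mem _ _ he, by rw [map_smul, hde], M, fun M' hM' => ?_⟩
      rw [smul_comm]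
      refine Submodule.smul_mem_smul hr ⟨Submodule.smul_mem _ _ he, ?_⟩
      change C.d i (y ^ M' • e) = 0
      rw [map_smul, hde, ← Nat.sub_add_cancel hM', pow_add, mul_smul, hM,
        smul_zero]
    · rintro c c' ⟨e, he, hde, M, hM⟩ ⟨e', he', hde', M', hM'⟩
      refine ⟨e + e', Submodule.add_mem _ he he', by rw [map_add, hde, hde'], max M M',
        fun m hm => ?_⟩
      rw [smul_add]
      exact Submodule.add_mem _ (hM m (le_of_max_le_left hm)) (hM' m (le_of_max_le_right hm))
  obtain ⟨e, he, hde, M0, hM0⟩ := claim _ hmem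
  obtain ⟨M1, hM1⟩ := mem_Gam_span_singleton.1 (Gam_anti (le_sup_right (a := J)) hb)
  set M := max (max M0 M1) N with hM
  have hbM : y ^ M • b = 0 := by
    rw [← Nat.sub_add_cancel (show M1 ≤ M by omega), pow_add, mul_smul, hM1, smul_zero]
  set q := (g * l.prod ^ N) • w - e - b with hq
  have hqZ : q ∈ Zc C J i := by
    refine ⟨Submodule.sub_mem _ (Submodule.sub_mem _ (Submodule.smul_mem _ _ hw) he)
      (Gam_anti le_sup_left hb), ?_⟩
    change C.d i q = 0
    rw [hq, map_sub, map_sub, map_smul, hde]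
    abel
  have key : (g * l.prod ^ N * y ^ M) • z = y ^ (M + 1) • q + y ^ (M + 1) • e := by
    rw [hq, smul_sub, smul_sub, pow_succ' y M, mul_smul y (y ^ M) b, hbM, smul_zero, ← hyw,
      smul_smul, smul_smul]
    rw [show y * y ^ M * (g * l.prod ^ N) = g * l.prod ^ N * y ^ M * y by ring]
    abel
  refine hG g hg M ?_
  have h1 : (g * (y :: l).prod ^ M) • z = (l.prod ^ (M - N)) • ((g * l.prod ^ N * y ^ M) • z) := by
    rw [smul_smul]
    congr 1
    rw [List.prod_cons, mul_pow]
    nth_rewrite 1 [← Nat.sub_add_cancel (show N ≤ M by omega)]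
    nth_rewrite 2 [← Nat.sub_add_cancel (show N ≤ M by omega)]
    rw [pow_add l.prod, Nat.sub_add_cancel (show N ≤ M by omega)]
    ring
  rw [h1, key, smul_add]
  refine Submodule.add_mem _ ?_ ?_
  · refine Submodule.smul_mem _ _ (Submodule.smul_mem_smul ?_ hqZ)
    exact Ideal.subset_span ⟨y, by simp, rfl⟩
  · have h2 := hM0 (M + 1) (by omega)
    have h3 : ∀ a ∈ powId l N, l.prod ^ (M - N) * a ∈ powId (y :: l) M := by
      intro a ha
      refine Submodule.span_induction (p := fun a _ => l.prod ^ (M - N) * a ∈ powId (y :: l) M)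
        ?_ ?_ ?_ ?_ ha
      · rintro _ ⟨x, hx, rfl⟩
        obtain ⟨c, hc⟩ := List.dvd_prod hx
        have : l.prod ^ (M - N) * x ^ (N + 1) = c ^ (M - N) * x ^ (M + 1) := by
          rw [hc, mul_pow, show M + 1 = (M - N) + (N + 1) by omega, pow_add]; ring
        simp only [this]
        exact Ideal.mul_mem_left _ _ (Ideal.subset_span ⟨x, by simp; right; exact hx, rfl⟩)
      · simp
      · intro a b _ _ h1 h2
        rw [mul_add]; exact Ideal.add_mem _ h1 h2
      · intro a b _ h
        rw [smul_eq_mul, mul_left_comm]; exact Ideal.mul_mem_left _ _ h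
    refine Submodule.smul_induction_on h2 ?_ ?_
    · intro r hr c hc
      rw [smul_smul]
      exact Submodule.smul_mem_smul (h3 r hr) hc
    · intro a b ha hb
      rw [smul_add]; exact Submodule.add_mem _ ha hb

/-- Regularity of a list of elements modulo `J`. -/
def RegL : Ideal R → List R → Prop
  | _, [] => True
  | J, y :: l => (∀ s, y * s ∈ J → s ∈ J) ∧ RegL (J ⊔ Ideal.span {y}) l

theorem chain [IsNoetherianRing R] [IsDomain R] {C : InjRes R} {G : Set R} (l : List R) :
    ∀ (y : R) (J : Ideal R) (i : ℕ) (z : C.E i), ExG C J i → z ∈ Ann J (C.E i) → C.d i z = 0 →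
      RegL J (y :: l) → GoodN C G (y :: l) J i z →
      ∃ m, m = i + l.length ∧ ∃ z' : C.E (m + 1),
        z' ∈ Ann (J ⊔ Ideal.span {x | x ∈ y :: l}) (C.E (m + 1)) ∧ C.d _ z' = 0 ∧
        ∀ g ∈ G, ∀ b ∈ Gam (J ⊔ Ideal.span {x | x ∈ y :: l}) (C.E m), C.d m b ≠ g • z' := by
  induction l with
  | nil =>
    intro y J i z hE hz hdz hR hG
    obtain ⟨w, hw, hyw⟩ := baer_divide (C.baer i) J y z (fun s hs => hz s (hR.1 s hs))
    have hs := good_step (Ann_le_Gam _ hw) hyw hG hE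
    have e : {x | x ∈ [y]} = {y} := by ext; simp
    rw [e]
    refine ⟨i, rfl, C.d i w, ?_, C.dd _ _, ?_⟩
    · intro a ha
      obtain ⟨b, hb, c, hc, rfl⟩ := Submodule.mem_sup.1 ha
      obtain ⟨c, rfl⟩ := Ideal.mem_span_singleton'.1 hc
      rw [add_smul, ← map_smul, hw b hb, map_zero, mul_smul, ← map_smul, hyw, hdz, smul_zero,
        add_zero]
    · intro g hg b hb h
      apply hs g hg 0 b hb
      rw [h]
      simp
  | cons y' l ih =>
    intro y J i z hE hz hdz hR hG
    obtain ⟨w, hw, hyw⟩ := baer_divide (C.baer i) J y z (fun s hs => hz s (hR.1 s hs))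
    have hs := good_step (Ann_le_Gam _ hw) hyw hG hE
    obtain ⟨m, hm, z', h1, h2, h3⟩ := ih y' (J ⊔ Ideal.span {y}) (i + 1) (C.d i w)
      (ExG_step y hE) (by
        intro a ha
        obtain ⟨b, hb, c, hc, rfl⟩ := Submodule.mem_sup.1 ha
        obtain ⟨c, rfl⟩ := Ideal.mem_span_singleton'.1 hc
        rw [add_smul, ← map_smul, hw b hb, map_zero, mul_smul, ← map_smul, hyw, hdz, smul_zero,
          add_zero]) (C.dd _ _) hR.2 (by
        intro g hg N
        have := hs g hg N 0 (Submodule.zero_mem _)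
        rwa [map_zero, sub_zero] at this)
    have e : {x | x ∈ y :: y' :: l} = {y} ∪ {x | x ∈ y' :: l} := by ext; simp
    rw [e, Ideal.span_union, ← sup_assoc]
    exact ⟨m, by rw [hm, List.length_cons]; omega, z', h1, h2, h3⟩

/-- The nonvanishing theorem. -/
theorem nonvanishing [IsNoetherianRing R] [IsDomain R] (C : InjRes R) (G : Set R) (y : R)
    (l : List R) (hR : RegL ⊥ (y :: l))
    (hG : ∀ g ∈ G, ∀ N, g * (y :: l).prod ^ N ∉ powId (y :: l) N) :
    ∃ z' : C.E (l.length + 1),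
        z' ∈ Ann (Ideal.span {x | x ∈ y :: l}) (C.E (l.length + 1)) ∧ C.d _ z' = 0 ∧
        ∀ g ∈ G, ∀ b ∈ Gam (Ideal.span {x | x ∈ y :: l}) (C.E l.length),
          C.d l.length b ≠ g • z' := by
  obtain ⟨m, hm, h⟩ := chain (C := C) (G := G) l y ⊥ 0 (C.eta 1) (ExG_bot C)
    (by intro a ha; rw [Ideal.mem_bot] at ha; rw [ha, zero_smul]) (C.d_eta 1) hR (by
      intro g hg N hmem
      apply hG g hg N
      have : ∀ c ∈ powId (y :: l) N • Zc C ⊥ 0, ∃ a ∈ powId (y :: l) N, C.eta a = c := by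
        intro c hc
        refine Submodule.smul_induction_on hc ?_ ?_
        · rintro r hr c ⟨-, hc⟩
          obtain ⟨x, rfl⟩ := C.ker_zero c hc
          exact ⟨r * x, Ideal.mul_mem_right _ _ hr, by rw [← smul_eq_mul, map_smul]⟩
        · rintro _ _ ⟨a, ha, rfl⟩ ⟨b, hb, rfl⟩
          exact ⟨a + b, Ideal.add_mem _ ha hb, map_add _ _ _⟩
      obtain ⟨a, ha, he⟩ := this _ hmem
      rw [← map_smul] at he
      have := C.eta_inj he
      rw [this] at ha
      simpa using ha)
  rw [zero_add] at hm
  subst hm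
  rw [bot_sup_eq] at h
  exact h

end Exactness

section FreeRes
variable {R : Type u} [CommRing R]

/-- `M` has a resolution of length at most `p` by finite free modules. -/
def FR (R : Type u) [CommRing R] : ℕ → ∀ (M : Type u) [AddCommGroup M] [Module R M], Prop
  | 0, M, _, _ => Module.Free R M ∧ Module.Finite R M
  | p + 1, M, _, _ => ∃ (F : Type u) (_ : AddCommGroup F) (_ : Module R F) (_ : Module.Free R F)
      (_ : Module.Finite R F) (π : F →ₗ[R] M), Function.Surjective π ∧ FR R p (LinearMap.ker π)

theorem FR_congr : ∀ (p : ℕ) {M N : Type u} [AddCommGroup M] [Module R M] [AddCommGroup N]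
    [Module R N] (_ : M ≃ₗ[R] N), FR R p M → FR R p N
  | 0, _, _, _, _, _, _, e, ⟨_, _⟩ => ⟨Module.Free.of_equiv e, Module.Finite.equiv e⟩
  | p + 1, M, N, _, _, _, _, e, ⟨F, i1, i2, i3, i4, π, hπ, hK⟩ => by
    refine ⟨F, i1, i2, i3, i4, e.toLinearMap ∘ₗ π, e.surjective.comp hπ, ?_⟩
    rw [LinearEquiv.ker_comp]
    exact hK

theorem FR_succ : ∀ (p : ℕ) {M : Type u} [AddCommGroup M] [Module R M], FR R p M → FR R (p + 1) M
  | 0, M, _, _, ⟨h1, h2⟩ => by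
    refine ⟨M, inferInstance, inferInstance, h1, h2, LinearMap.id, Function.surjective_id, ?_⟩
    rw [LinearMap.ker_id]
    exact ⟨inferInstance, inferInstance⟩
  | p + 1, M, _, _, ⟨F, i1, i2, i3, i4, π, hπ, hK⟩ =>
    ⟨F, i1, i2, i3, i4, π, hπ, FR_succ p hK⟩

theorem FR_mono {p q : ℕ} (h : p ≤ q) {M : Type u} [AddCommGroup M] [Module R M]
    (H : FR R p M) : FR R q M := by
  induction q, h using Nat.le_induction with
  | base => exact H
  | succ q _ ih => exact FR_succ q ih

theorem FR_horseshoe : ∀ (p : ℕ) {A B C : Type u} [AddCommGroup A] [Module R A] [AddCommGroup B]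
    [Module R B] [AddCommGroup C] [Module R C] (f : A →ₗ[R] B) (g : B →ₗ[R] C)
    (_ : Function.Injective f) (_ : Function.Surjective g)
    (_ : LinearMap.range f = LinearMap.ker g), FR R p A → FR R p C → FR R p B
  | 0, A, B, C, _, _, _, _, _, _, f, g, hf, hg, hfg, ⟨_, _⟩, ⟨_, _⟩ => by
    obtain ⟨s, hs⟩ := Module.projective_lifting_property g LinearMap.id hg
    have e := lequivProdOfRightSplitExact hf hfg hs
    exact ⟨Module.Free.of_equiv e, Module.Finite.equiv e⟩
  | p + 1, A, B, C, _, _, _, _, _, _, f, g, hf, hg, hfg, ⟨F, i1, i2, i3, i4, π, hπ, hK⟩,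
      ⟨G, j1, j2, j3, j4, ρ, hρ, hL⟩ => by
    obtain ⟨τ, hτ⟩ := Module.projective_lifting_property g ρ hg
    have hτ' : ∀ y, g (τ y) = ρ y := fun y => LinearMap.congr_fun hτ y
    have hgf : ∀ a, g (f a) = 0 := fun a => by
      have : f a ∈ LinearMap.ker g := hfg ▸ LinearMap.mem_range_self f a
      exact this
    let σ : F × G →ₗ[R] B := (f ∘ₗ π).coprod τ
    have hσ : ∀ x y, σ (x, y) = f (π x) + τ y := fun x y => by simp [σ]
    refine ⟨F × G, inferInstance, inferInstance, inferInstance, inferInstance, σ, ?_, ?_⟩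
    · intro b
      obtain ⟨y, hy⟩ := hρ (g b)
      have : b - τ y ∈ LinearMap.range f := by
        rw [hfg, LinearMap.mem_ker, map_sub, hτ', hy, sub_self]
      obtain ⟨a, ha⟩ := this
      obtain ⟨x, rfl⟩ := hπ a
      exact ⟨(x, y), by rw [hσ, ha, sub_add_cancel]⟩
    · let φ : LinearMap.ker π →ₗ[R] LinearMap.ker σ :=
        ((LinearMap.inl R F G) ∘ₗ (LinearMap.ker π).subtype).codRestrict _ (by
          rintro ⟨x, hx⟩
          rw [LinearMap.mem_ker] at hx
          simp [σ, hx])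
      let ψ : LinearMap.ker σ →ₗ[R] LinearMap.ker ρ :=
        ((LinearMap.snd R F G) ∘ₗ (LinearMap.ker σ).subtype).codRestrict _ (by
          rintro ⟨⟨x, y⟩, hx⟩
          rw [LinearMap.mem_ker, hσ] at hx
          have := congrArg g hx
          rw [map_add, hgf, zero_add, hτ', map_zero] at this
          simpa using this)
      refine FR_horseshoe p φ ψ ?_ ?_ ?_ hK hL
      · rintro ⟨x, hx⟩ ⟨y, hy⟩ h
        have := congrArg (fun t => t.1.1) h
        simpa [φ] using this
      · rintro ⟨y, hy⟩
        rw [LinearMap.mem_ker] at hy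
        have : τ y ∈ LinearMap.range f := by
          rw [hfg, LinearMap.mem_ker, hτ', hy]
        obtain ⟨a, ha⟩ := this
        obtain ⟨x, rfl⟩ := hπ a
        refine ⟨⟨(-x, y), ?_⟩, ?_⟩
        · rw [LinearMap.mem_ker, hσ, map_neg, map_neg, ha, neg_add_cancel]
        · rfl
      · ext ⟨⟨x, y⟩, h⟩
        rw [LinearMap.mem_ker, hσ] at h
        constructor
        · rintro ⟨⟨x', hx'⟩, h'⟩
          have := congrArg (fun t => t.1.2) h'
          simp only [φ] at this
          apply Subtype.ext
          exact this.symm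
        · intro h'
          have hy : y = 0 := congrArg (fun t => t.1) h'
          subst hy
          rw [map_zero, add_zero] at h
          refine ⟨⟨x, ?_⟩, rfl⟩
          exact hf (by rw [h, map_zero])

theorem FR_coker (p : ℕ) {A B C : Type u} [AddCommGroup A] [Module R A] [AddCommGroup B]
    [Module R B] [AddCommGroup C] [Module R C] (f : A →ₗ[R] B) (g : B →ₗ[R] C)
    (hf : Function.Injective f) (hg : Function.Surjective g)
    (hfg : LinearMap.range f = LinearMap.ker g) (hA : FR R p A) (hB : FR R (p + 1) B) :
    FR R (p + 1) C := by
  obtain ⟨F, i1, i2, i3, i4, π, hπ, hK⟩ := hB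
  refine ⟨F, i1, i2, i3, i4, g ∘ₗ π, hg.comp hπ, ?_⟩
  have hle : LinearMap.ker π ≤ LinearMap.ker (g ∘ₗ π) := by
    intro x hx
    rw [LinearMap.mem_ker] at hx ⊢
    rw [LinearMap.comp_apply, hx, map_zero]
  let e := LinearEquiv.ofInjective f hf
  let ψ : LinearMap.ker (g ∘ₗ π) →ₗ[R] LinearMap.range f :=
    (π ∘ₗ (LinearMap.ker (g ∘ₗ π)).subtype).codRestrict _ (by
      rintro ⟨x, hx⟩
      rw [hfg]
      exact hx)
  refine FR_horseshoe p (Submodule.inclusion hle) (e.symm.toLinearMap ∘ₗ ψ)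
    (Submodule.inclusion_injective hle) (e.symm.surjective.comp ?_) ?_ hK hA
  · rintro ⟨b, hb⟩
    obtain ⟨x, rfl⟩ := hπ b
    refine ⟨⟨x, ?_⟩, rfl⟩
    rw [hfg] at hb
    exact hb
  · rw [LinearEquiv.ker_comp]
    ext ⟨x, hx⟩
    constructor
    · rintro ⟨⟨y, hy⟩, h⟩
      have : y = x := congrArg (fun t => t.1) h
      subst this
      exact Subtype.ext hy
    · intro h
      have : π x = 0 := congrArg (fun t => t.1) h
      exact ⟨⟨x, this⟩, rfl⟩

theorem FR_hom (C : InjRes R) : ∀ (p : ℕ) {M : Type u} [AddCommGroup M] [Module R M],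
    FR R p M → ∀ i, p ≤ i → ∀ χ : M →ₗ[R] C.E (i + 1), (∀ x, C.d (i + 1) (χ x) = 0) →
      ∃ ψ : M →ₗ[R] C.E i, ∀ x, C.d i (ψ x) = χ x := by
  have lift : ∀ {M : Type u} [AddCommGroup M] [Module R M] [Module.Projective R M], 
      ∀ i, ∀ χ : M →ₗ[R] C.E (i + 1), (∀ x, C.d (i + 1) (χ x) = 0) →
      ∃ ψ : M →ₗ[R] C.E i, ∀ x, C.d i (ψ x) = χ x := by
    intro M _ _ _ i χ hχ
    let D : C.E i →ₗ[R] LinearMap.ker (C.d (i + 1)) := (C.d i).codRestrict _ (fun e => C.dd i e)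
    obtain ⟨ψ, hψ⟩ := Module.projective_lifting_property D
      (χ.codRestrict (LinearMap.ker (C.d (i + 1))) hχ) (by
        rintro ⟨e, he⟩
        obtain ⟨w, hw⟩ := C.exact i e he
        exact ⟨w, Subtype.ext hw⟩)
    exact ⟨ψ, fun x => congrArg Subtype.val (LinearMap.congr_fun hψ x)⟩
  intro p
  induction p with
  | zero =>
    intro M _ _ ⟨h1, h2⟩ i _ χ hχ
    exact lift i χ hχ
  | succ p ih =>
    intro M _ _ ⟨F, i1, i2, i3, i4, π, hπ, hK⟩ i hi χ hχ
    obtain ⟨j, rfl⟩ : ∃ j, i = j + 1 := ⟨i - 1, by omega⟩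
    obtain ⟨φ, hφ⟩ := lift (j + 1) (χ ∘ₗ π) (fun x => hχ _)
    obtain ⟨ω, hω⟩ := ih hK j (by omega) (φ ∘ₗ (LinearMap.ker π).subtype) (by
      rintro ⟨x, hx⟩
      rw [LinearMap.mem_ker] at hx
      change C.d (j + 1) (φ x) = 0
      rw [hφ, LinearMap.comp_apply, hx, map_zero])
    obtain ⟨ω', hω'⟩ := baer_extend (C.baer j) (LinearMap.ker π).subtype ω (by
      intro x hx
      have : x = 0 := Subtype.ext hx
      rw [this, map_zero])
    obtain ⟨ψ, hψ⟩ := baer_extend (C.baer (j + 1)) π (φ - C.d j ∘ₗ ω') (by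
      intro x hx
      have h1 := hω' ⟨x, hx⟩
      have h2 := hω ⟨x, hx⟩
      rw [← h1] at h2
      simp only [LinearMap.sub_apply, LinearMap.comp_apply, Submodule.subtype_apply] at h2 ⊢
      rw [h2, sub_self])
    refine ⟨ψ, fun x => ?_⟩
    obtain ⟨y, rfl⟩ := hπ x
    rw [hψ, LinearMap.sub_apply, map_sub, hφ, LinearMap.comp_apply, LinearMap.comp_apply, C.dd,
      sub_zero]

theorem ExA_of_FR (C : InjRes R) (J : Ideal R) (p : ℕ) (h : FR R p (R ⧸ J)) : ExA C J p := by
  intro i hi z hz hdz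
  obtain ⟨ψ, hψ⟩ := FR_hom C p h i hi
    (Submodule.liftQ J (LinearMap.toSpanSingleton R _ z) (by
      intro a ha
      exact hz a ha)) (by
      intro x
      obtain ⟨x, rfl⟩ := Submodule.Quotient.mk_surjective _ x
      change C.d (i + 1) (x • z) = 0
      rw [map_smul, hdz, smul_zero])
  refine ⟨ψ (Submodule.Quotient.mk 1), ?_, ?_⟩
  · intro a ha
    rw [← map_smul, ← Submodule.Quotient.mk_smul, smul_eq_mul, mul_one,
      (Submodule.Quotient.mk_eq_zero J).2 ha, map_zero]
  · rw [hψ]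
    exact one_smul _ _

/-- Resolutions in explicit form. -/
def Res (R : Type u) [CommRing R] (M : Type u) [AddCommGroup M] [Module R M] (q : ℕ) : Prop :=
  ∃ (ι : ℕ → Type) (_ : ∀ m, Fintype (ι m))
    (f : ∀ m, ((ι (m + 1)) →₀ R) →ₗ[R] ((ι m) →₀ R))
    (g : ((ι 0) →₀ R) →ₗ[R] M),
    Function.Surjective g ∧
    LinearMap.range (f 0) = LinearMap.ker g ∧
    (∀ m, LinearMap.range (f (m + 1)) = LinearMap.ker (f m)) ∧
    (∀ m, q ≤ m → IsEmpty (ι m))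

theorem Res_zero (M : Type u) [AddCommGroup M] [Module R M] [Subsingleton M] : Res R M 0 := by
  refine ⟨fun _ => Empty, fun _ => inferInstance, fun _ => 0, 0, ?_, ?_, ?_, ?_⟩
  · intro x; exact ⟨0, Subsingleton.elim _ _⟩
  · exact Subsingleton.elim _ _
  · intro m; exact Subsingleton.elim _ _
  · intro m _; infer_instance

/-- Prepend an index type. -/
def consIdx (r : ℕ) (ι : ℕ → Type) : ℕ → Type
  | 0 => Fin r
  | m + 1 => ι m

/-- Prepend a map. -/
def consMap (r : ℕ) (ι : ℕ → Type) (f : ∀ m, ((ι (m + 1)) →₀ R) →ₗ[R] ((ι m) →₀ R))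
    (g : (ι 0 →₀ R) →ₗ[R] (Fin r →₀ R)) :
    ∀ m, ((consIdx r ι (m + 1)) →₀ R) →ₗ[R] ((consIdx r ι m) →₀ R)
  | 0 => g
  | m + 1 => f m

theorem Res_succ {M F : Type u} [AddCommGroup M] [Module R M] [AddCommGroup F] [Module R F]
    [Module.Free R F] [Module.Finite R F] (π : F →ₗ[R] M) (hπ : Function.Surjective π) {q : ℕ}
    (h : Res R (LinearMap.ker π) q) : Res R M (q + 1) := by
  obtain ⟨ι, i, f, g, hg, h0, hf, hq⟩ := h
  obtain ⟨r, ⟨b⟩⟩ : ∃ r : ℕ, Nonempty (F ≃ₗ[R] (Fin r →₀ R)) := by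
    let b := Module.Free.chooseBasis R F
    exact ⟨_, ⟨b.repr ≪≫ₗ Finsupp.domLCongr (Fintype.equivFin _)⟩⟩
  let φ : (ι 0 →₀ R) →ₗ[R] (Fin r →₀ R) := b.toLinearMap ∘ₗ (LinearMap.ker π).subtype ∘ₗ g
  have hφ : ∀ y, φ y = b (g y).1 := fun y => rfl
  have h1 : LinearMap.range φ = LinearMap.ker (π ∘ₗ b.symm.toLinearMap) := by
    ext x
    constructor
    · rintro ⟨y, rfl⟩
      simp [hφ]
    · intro hx
      obtain ⟨y, hy⟩ := hg ⟨b.symm x, hx⟩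
      exact ⟨y, by simp [hφ, hy]⟩
  have h2 : LinearMap.range (f 0) = LinearMap.ker φ := by
    rw [h0]
    ext x
    simp [hφ]
  refine ⟨consIdx r ι, fun m => ?_, consMap r ι f φ, π ∘ₗ b.symm.toLinearMap,
    hπ.comp b.symm.surjective, h1, ?_, ?_⟩
  · cases m
    · exact (inferInstance : Fintype (Fin r))
    · exact i _
  · intro m
    cases m with
    | zero => exact h2
    | succ m => exact hf m
  · intro m hm
    cases m with
    | zero => omega
    | succ m => exact hq m (by omega)

theorem Res_of_FR : ∀ (p : ℕ) {M : Type u} [AddCommGroup M] [Module R M],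
    FR R p M → Res R M (p + 1)
  | 0, M, _, _, ⟨_, _⟩ => by
    have : Subsingleton (LinearMap.ker (LinearMap.id : M →ₗ[R] M)) := by
      rw [LinearMap.ker_id]; infer_instance
    exact Res_succ LinearMap.id Function.surjective_id (Res_zero _)
  | p + 1, M, _, _, ⟨F, i1, i2, i3, i4, π, hπ, hK⟩ => Res_succ π hπ (Res_of_FR p hK)

theorem FR_of_Res : ∀ (p : ℕ) {M : Type u} [AddCommGroup M] [Module R M],
    Res R M (p + 1) → FR R p M
  | 0, M, _, _, ⟨ι, i, f, g, hg, h0, hf, hq⟩ => by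
    have := hq 1 le_rfl
    have hinj : LinearMap.ker g = ⊥ := by
      rw [← h0, LinearMap.range_eq_bot]
      exact Subsingleton.elim _ _
    have e := LinearEquiv.ofBijective g ⟨LinearMap.ker_eq_bot.1 hinj, hg⟩
    exact ⟨Module.Free.of_equiv e, Module.Finite.equiv e⟩
  | p + 1, M, _, _, ⟨ι, i, f, g, hg, h0, hf, hq⟩ => by
    refine ⟨ι 0 →₀ R, inferInstance, inferInstance, inferInstance, inferInstance, g, hg, ?_⟩
    apply FR_of_Res p
    refine ⟨fun m => ι (m + 1), fun m => i _, fun m => f (m + 1),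
      (f 0).codRestrict _ (fun x => h0 ▸ LinearMap.mem_range_self (f 0) x), ?_, ?_, ?_, ?_⟩
    · rintro ⟨x, hx⟩
      rw [← h0] at hx
      obtain ⟨y, hy⟩ := hx
      exact ⟨y, Subtype.ext hy⟩
    · rw [LinearMap.ker_codRestrict]; exact hf 0
    · intro m; exact hf (m + 1)
    · intro m hm; exact hq _ (by omega)

end FreeRes

open MvPolynomial
section SeqLemmas
variable {R : Type u} [CommRing R]

theorem quot_seq (J J' J'' : Ideal R) (x : R) (h1 : ∀ p, x * p ∈ J ↔ p ∈ J')
    (h2 : J'' = J ⊔ Ideal.span {x}) :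
    ∃ (f : (R ⧸ J') →ₗ[R] (R ⧸ J)) (g : (R ⧸ J) →ₗ[R] (R ⧸ J'')), Function.Injective f ∧
      Function.Surjective g ∧ LinearMap.range f = LinearMap.ker g := by
  have hle : J ≤ J'' := h2 ▸ le_sup_left
  refine ⟨Submodule.mapQ J' J (LinearMap.mulLeft R x) (fun p hp => (h1 p).2 hp),
    Submodule.factor hle, ?_, Submodule.factor_surjective hle, ?_⟩
  · rw [injective_iff_map_eq_zero]
    intro a ha
    obtain ⟨a, rfl⟩ := Submodule.Quotient.mk_surjective _ a
    change Submodule.Quotient.mk (x * a) = (0 : R ⧸ J) at ha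
    rw [Submodule.Quotient.mk_eq_zero] at ha ⊢
    exact (h1 a).1 ha
  · ext a
    obtain ⟨a, rfl⟩ := Submodule.Quotient.mk_surjective _ a
    constructor
    · rintro ⟨b, hb⟩
      obtain ⟨b, rfl⟩ := Submodule.Quotient.mk_surjective _ b
      change Submodule.Quotient.mk (x * b) = (Submodule.Quotient.mk a : R ⧸ J) at hb
      rw [← hb]
      change Submodule.Quotient.mk (x * b) = (0 : R ⧸ J'')
      rw [Submodule.Quotient.mk_eq_zero, h2]
      exact Ideal.mul_mem_right _ _ (Ideal.mem_sup_right (Ideal.subset_span rfl))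
    · intro ha
      change Submodule.Quotient.mk a = (0 : R ⧸ J'') at ha
      rw [Submodule.Quotient.mk_eq_zero, h2] at ha
      obtain ⟨b, hb, c, hc, rfl⟩ := Submodule.mem_sup.1 ha
      obtain ⟨c, rfl⟩ := Ideal.mem_span_singleton'.1 hc
      refine ⟨Submodule.Quotient.mk c, ?_⟩
      change Submodule.Quotient.mk (x * c) = (Submodule.Quotient.mk _ : R ⧸ J)
      rw [Submodule.Quotient.eq]
      have : x * c - (b + c * x) = -b := by ring
      rw [this]
      exact J.neg_mem hb

end SeqLemmas

section Mono
variable {k : Type u} [Field k] {n : ℕ}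

/-- The ideal generated by the edges of `e` and the variables in `W`. -/
noncomputable def eI (k : Type u) [Field k] {n : ℕ} (e : Fin n → Fin n → Prop)
    (W : Finset (Fin n)) : Ideal (MvPolynomial (Fin n) k) :=
  Ideal.span ((fun m : Fin n →₀ ℕ => monomial m (1 : k)) ''
    {m | (∃ a b, e a b ∧ m a ≠ 0 ∧ m b ≠ 0) ∨ ∃ a ∈ W, m a ≠ 0})

theorem mem_eI {e : Fin n → Fin n → Prop} {W : Finset (Fin n)} {p : MvPolynomial (Fin n) k} :
    p ∈ eI k e W ↔ ∀ m ∈ p.support, (∃ a b, e a b ∧ m a ≠ 0 ∧ m b ≠ 0) ∨ ∃ a ∈ W, m a ≠ 0 := by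
  rw [eI, MvPolynomial.mem_ideal_span_monomial_image]
  refine forall₂_congr fun m hm => ?_
  constructor
  · rintro ⟨s, hs, hle⟩
    have hle' : ∀ a, s a ≠ 0 → m a ≠ 0 := fun a ha => by have := hle a; omega
    rcases hs with ⟨a, b, h, h1, h2⟩ | ⟨a, h, h1⟩
    · exact Or.inl ⟨a, b, h, hle' _ h1, hle' _ h2⟩
    · exact Or.inr ⟨a, h, hle' _ h1⟩
  · intro h
    exact ⟨m, h, le_rfl⟩

theorem single_add_ne {v a : Fin n} {m : Fin n →₀ ℕ} :
    (Finsupp.single v 1 + m : Fin n →₀ ℕ) a ≠ 0 ↔ a = v ∨ m a ≠ 0 := by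
  by_cases h : a = v
  · subst h; simp
  · simp [Finsupp.single_apply, Ne.symm h, h]

theorem mem_X_mul {v : Fin n} {p : MvPolynomial (Fin n) k} {Q : (Fin n →₀ ℕ) → Prop} :
    (∀ m ∈ (X v * p).support, Q m) ↔ ∀ m ∈ p.support, Q (Finsupp.single v 1 + m) := by
  rw [support_X_mul]
  simp

theorem X_mem_eI {e : Fin n → Fin n → Prop} {W : Finset (Fin n)} {v : Fin n} (h : v ∈ W) :
    (X v : MvPolynomial (Fin n) k) ∈ eI k e W := by
  rw [mem_eI]
  intro m hm
  rw [support_X, Finset.mem_singleton] at hm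
  exact Or.inr ⟨v, h, by simp [hm]⟩

theorem XX_mem_eI {e : Fin n → Fin n → Prop} {W : Finset (Fin n)} {v w : Fin n} (h : e v w) :
    (X v * X w : MvPolynomial (Fin n) k) ∈ eI k e W := by
  rw [mem_eI, mem_X_mul]
  intro m hm
  rw [support_X, Finset.mem_singleton] at hm
  exact Or.inl ⟨v, w, h, single_add_ne.2 (Or.inl rfl), single_add_ne.2 (Or.inr (by simp [hm]))⟩

theorem eI_mono {e e' : Fin n → Fin n → Prop} {W W' : Finset (Fin n)} 
    (h : ∀ a b, e a b → e' a b ∨ a ∈ W' ∨ b ∈ W') (hW : W ⊆ W') : eI k e W ≤ eI k e' W' := by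
  intro p hp
  rw [mem_eI] at hp ⊢
  intro m hm
  rcases hp m hm with ⟨a, b, h1, h2, h3⟩ | ⟨a, h1, h2⟩
  · rcases h a b h1 with h | h | h
    · exact Or.inl ⟨a, b, h, h2, h3⟩
    · exact Or.inr ⟨a, h, h2⟩
    · exact Or.inr ⟨b, h, h3⟩
  · exact Or.inr ⟨a, hW h1, h2⟩

theorem eI_le_of {e : Fin n → Fin n → Prop} {W : Finset (Fin n)} {J : Ideal (MvPolynomial (Fin n) k)}
    (hi : ∀ a, ¬ e a a)
    (h : ∀ a b, e a b → (X a * X b : MvPolynomial (Fin n) k) ∈ J)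
    (hW : ∀ a ∈ W, (X a : MvPolynomial (Fin n) k) ∈ J) : eI k e W ≤ J := by
  rw [eI, Ideal.span_le]
  have key : ∀ (m : Fin n →₀ ℕ) a, m a ≠ 0 →
      (monomial m (1 : k)) = X a * monomial (m - Finsupp.single a 1) 1 := by
    intro m a ha
    rw [X, monomial_mul, one_mul, add_tsub_cancel_of_le]
    intro b
    by_cases h : a = b
    · subst h; simp; omega
    · simp [Finsupp.single_apply, h]
  rintro _ ⟨m, ⟨a, b, h1, h2, h3⟩ | ⟨a, h1, h2⟩, rfl⟩
  · change (monomial m (1 : k)) ∈ J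
    rw [key m a h2, key (m - Finsupp.single a 1) b, ← mul_assoc]
    · exact Ideal.mul_mem_right _ _ (h a b h1)
    · have : a ≠ b := by rintro rfl; exact hi _ h1
      simpa [Finsupp.single_apply, this] using h3
  · change (monomial m (1 : k)) ∈ J
    rw [key m a h2]
    exact Ideal.mul_mem_right _ _ (hW a h1)

open Classical in
/-- Neighbours. -/
noncomputable def nb (e : Fin n → Fin n → Prop) (v : Fin n) : Finset (Fin n) :=
  Finset.univ.filter (fun b => e v b)

theorem mem_nb {e : Fin n → Fin n → Prop} {v b : Fin n} : b ∈ nb e v ↔ e v b := by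
  simp [nb]

theorem eI_colon {e : Fin n → Fin n → Prop} (hs : ∀ a b, e a b → e b a) (hi : ∀ a, ¬ e a a)
    {W : Finset (Fin n)} {v : Fin n} (hv : v ∉ W) (p : MvPolynomial (Fin n) k) :
    X v * p ∈ eI k e W ↔ p ∈ eI k e (W ∪ nb e v) := by
  rw [mem_eI, mem_eI, mem_X_mul]
  refine forall₂_congr fun m _ => ?_
  simp only [single_add_ne]
  constructor
  · rintro (⟨a, b, h, h1, h2⟩ | ⟨a, h, h1⟩)
    · rcases h1 with rfl | h1
      · rcases h2 with rfl | h2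
        · exact absurd h (hi _)
        · exact Or.inr ⟨b, Finset.mem_union_right _ (mem_nb.2 h), h2⟩
      · rcases h2 with rfl | h2
        · exact Or.inr ⟨a, Finset.mem_union_right _ (mem_nb.2 (hs _ _ h)), h1⟩
        · exact Or.inl ⟨a, b, h, h1, h2⟩
    · rcases h1 with rfl | h1
      · exact absurd h hv
      · exact Or.inr ⟨a, Finset.mem_union_left _ h, h1⟩
  · rintro (⟨a, b, h, h1, h2⟩ | ⟨a, h, h1⟩)
    · exact Or.inl ⟨a, b, h, Or.inr h1, Or.inr h2⟩
    · rcases Finset.mem_union.1 h with h | h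
      · exact Or.inr ⟨a, h, Or.inr h1⟩
      · exact Or.inl ⟨v, a, mem_nb.1 h, Or.inl rfl, Or.inr h1⟩

theorem eI_insert {e : Fin n → Fin n → Prop} (hi : ∀ a, ¬ e a a) (W : Finset (Fin n)) (v : Fin n) :
    eI k e (insert v W) = eI k e W ⊔ Ideal.span {X v} := by
  apply le_antisymm
  · apply eI_le_of hi
    · intro a b h; exact Ideal.mem_sup_left (XX_mem_eI h)
    · intro a ha
      rcases Finset.mem_insert.1 ha with rfl | ha
      · exact Ideal.mem_sup_right (Ideal.subset_span rfl)
      · exact Ideal.mem_sup_left (X_mem_eI ha)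
  · apply sup_le
    · exact eI_mono (fun a b h => Or.inl h) (Finset.subset_insert _ _)
    · rw [Ideal.span_singleton_le_iff_mem]
      exact X_mem_eI (Finset.mem_insert_self _ _)

/-- The quotient by an edge ideal has a resolution of length `q`. -/
def EFR (k : Type u) [Field k] {n : ℕ} (e : Fin n → Fin n → Prop) (W : Finset (Fin n)) (q : ℕ) :
    Prop := FR (MvPolynomial (Fin n) k) q (MvPolynomial (Fin n) k ⧸ eI k e W)

theorem EFR_split {e : Fin n → Fin n → Prop} (hs : ∀ a b, e a b → e b a) (hi : ∀ a, ¬ e a a)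
    {W : Finset (Fin n)} {v : Fin n} (hv : v ∉ W) {q : ℕ} (h1 : EFR k e (W ∪ nb e v) q)
    (h2 : EFR k e (insert v W) q) : EFR k e W q := by
  obtain ⟨f, g, hf, hg, hfg⟩ := quot_seq _ _ _ _ (eI_colon (k := k) hs hi hv) (eI_insert hi W v)
  exact FR_horseshoe q f g hf hg hfg h1 h2

theorem EFR_cover0 (W : Finset (Fin n)) : EFR k (fun _ _ : Fin n => False) W W.card := by
  induction W using Finset.induction_on with
  | empty =>
    have : eI k (fun _ _ : Fin n => False) ∅ = ⊥ := by
      rw [eq_bot_iff]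
      exact eI_le_of (by simp) (by simp) (by simp)
    refine FR_congr 0 (Submodule.quotEquivOfEqBot _ this).symm ⟨inferInstance, inferInstance⟩
  | insert v W hv ih =>
    have hN : W ∪ nb (fun _ _ : Fin n => False) v = W := by
      ext; simp [mem_nb]
    have hc := eI_colon (k := k) (e := fun _ _ : Fin n => False) (by simp) (by simp) hv
    rw [hN] at hc
    obtain ⟨f, g, hf, hg, hfg⟩ := quot_seq _ _ _ _ hc (eI_insert (by simp) W v)
    rw [Finset.card_insert_of_notMem hv]
    exact FR_coker W.card f g hf hg hfg ih (FR_succ _ ih)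

theorem EFR_mono {e : Fin n → Fin n → Prop} {W : Finset (Fin n)} {p q : ℕ} (h : p ≤ q)
    (H : EFR k e W p) : EFR k e W q := FR_mono h H

theorem EFR_cover {e : Fin n → Fin n → Prop} (W : Finset (Fin n))
    (h : ∀ a b, e a b → a ∈ W ∨ b ∈ W) {q : ℕ} (hq : W.card ≤ q) : EFR k e W q := by
  have : eI k e W = eI k (fun _ _ : Fin n => False) W :=
    le_antisymm (eI_mono (fun a b hab => Or.inr (h a b hab)) subset_rfl)
      (eI_mono (fun a b hab => hab.elim) subset_rfl)
  have h2 := EFR_mono hq (EFR_cover0 (k := k) W)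
  rw [EFR] at h2 ⊢
  rw [this]
  exact h2

theorem EFR_gen {e : Fin n → Fin n → Prop} (hs : ∀ a b, e a b → e b a) (hi : ∀ a, ¬ e a a) :
    ∀ (c : ℕ) (U W : Finset (Fin n)), U.card = c → U.Nonempty → Disjoint U W →
      (∀ a b, e a b → a ∈ W ∨ b ∈ W ∨ (a ∈ U ∧ b ∈ U)) →
      ∀ q, W.card + U.card ≤ q + 1 → EFR k e W q := by
  intro c
  induction c using Nat.strong_induction_on with
  | _ c ih =>
  intro U W hc hU hd he q hq
  by_cases hex : ∃ a b, e a b ∧ a ∉ W ∧ b ∉ W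
  · obtain ⟨a, b, hab, haW, hbW⟩ := hex
    have hab' : a ∈ U ∧ b ∈ U := by
      have := he a b hab; tauto
    have hne : a ≠ b := by rintro rfl; exact hi _ hab
    have hins : (insert a W).card = W.card + 1 := Finset.card_insert_of_notMem haW
    have her : (U.erase a).card + 1 = U.card := Finset.card_erase_add_one hab'.1
    apply EFR_split hs hi haW
    · have hN : ∀ x, e a x → x ∈ W ∨ x ∈ U := fun x hx => by
        have := he a x hx; tauto
      have hsub : U \ (W ∪ nb e a) ⊂ U := by
        rw [Finset.ssubset_iff_of_subset Finset.sdiff_subset]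
        exact ⟨b, hab'.2, by simp [mem_nb, hab]⟩
      refine ih _ (by rw [← hc]; exact Finset.card_lt_card hsub) (U \ (W ∪ nb e a)) _ rfl ?_ ?_ ?_ q ?_
      · exact ⟨a, by simp [mem_nb, hab'.1, haW, hi]⟩
      · exact Finset.sdiff_disjoint
      · intro x y hxy
        have := he x y hxy
        simp only [Finset.mem_union, Finset.mem_sdiff]
        tauto
      · rw [← Finset.card_union_of_disjoint Finset.sdiff_disjoint.symm]
        refine le_trans (Finset.card_le_card (t := W ∪ U) ?_) ((Finset.card_union_le _ _).trans hq)
        intro x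
        simp only [Finset.mem_union, Finset.mem_sdiff, mem_nb]
        have := hN x
        tauto
    · refine ih _ (by omega) (U.erase a) (insert a W) rfl ⟨b, by simp [hne.symm, hab'.2]⟩ ?_ ?_ q
        (by omega)
      · rw [Finset.disjoint_left] at hd ⊢
        intro x hx
        have := hd (Finset.mem_of_mem_erase hx)
        simp [this, Finset.ne_of_mem_erase hx]
      · intro x y hxy
        have := he x y hxy
        simp only [Finset.mem_insert, Finset.mem_erase]
        tauto
  · push Not at hex
    apply EFR_cover
    · intro a b hab
      have := hex a b hab; tauto
    · have := hU.card_pos; omega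

/-- Connectedness of the complement graph, in constructive form. -/
inductive Conn (e : Fin n → Fin n → Prop) : Finset (Fin n) → Prop
  | base (a b : Fin n) (hne : a ≠ b) (h : ¬ e a b) : Conn e {a, b}
  | step (U : Finset (Fin n)) (v u : Fin n) (hU : Conn e U) (hv : v ∉ U) (hu : u ∈ U)
      (h : ¬ e v u) : Conn e (insert v U)

theorem Conn.two_le {e : Fin n → Fin n → Prop} {U : Finset (Fin n)} (h : Conn e U) :
    2 ≤ U.card := by
  induction h with
  | base a b hne h => rw [Finset.card_pair hne]
  | step U v u hU hv hu h ih => rw [Finset.card_insert_of_notMem hv]; omega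

theorem Conn.extend {e : Fin n → Fin n → Prop} {U V : Finset (Fin n)} (h : Conn e U)
    (hV : ∀ v ∈ V, v ∉ U → ∃ u ∈ U, ¬ e v u) : Conn e (U ∪ V) := by
  induction V using Finset.induction_on with
  | empty => simpa using h
  | insert v V hv ih =>
    have ih := ih (fun v hv => hV v (Finset.mem_insert_of_mem hv))
    rw [Finset.union_insert]
    by_cases hvU : v ∈ U ∪ V
    · rwa [Finset.insert_eq_of_mem hvU]
    · obtain ⟨u, hu, h1⟩ := hV v (Finset.mem_insert_self _ _)
        (fun h => hvU (Finset.mem_union_left _ h))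
      exact Conn.step _ v u ih hvU (Finset.mem_union_left _ hu) h1

theorem EFR_conn {e : Fin n → Fin n → Prop} (hs : ∀ a b, e a b → e b a) (hi : ∀ a, ¬ e a a)
    {U : Finset (Fin n)} (hU : Conn e U) : ∀ (W : Finset (Fin n)), Disjoint U W →
      (∀ a b, e a b → a ∈ W ∨ b ∈ W ∨ (a ∈ U ∧ b ∈ U)) →
      ∀ q, W.card + U.card ≤ q + 2 → EFR k e W q := by
  induction hU with
  | base a b hne h =>
    intro W hd he q hq
    rw [Finset.card_pair hne] at hq
    apply EFR_cover _ _ (by omega)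
    intro x y hxy
    have h1 := he x y hxy
    have h2 : ¬ e b a := fun h' => h (hs _ _ h')
    have h3 := hi a
    have h4 := hi b
    simp only [Finset.mem_insert, Finset.mem_singleton] at h1
    rcases h1 with h1 | h1 | ⟨rfl | rfl, rfl | rfl⟩ <;> tauto
  | step U v u hU hv hu h ih =>
    intro W hd he q hq
    rw [Finset.disjoint_insert_left] at hd
    have hcard := hU.two_le
    rw [Finset.card_insert_of_notMem hv] at hq
    apply EFR_split hs hi hd.1
    · have hN : ∀ x, e v x → x ∈ W ∨ x ∈ U := fun x hx => by
        have := he v x hx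
        have h1 : x ≠ v := by rintro rfl; exact hi _ hx
        have := hd.1
        simp only [Finset.mem_insert] at *
        tauto
      refine EFR_gen hs hi _ (U \ (W ∪ nb e v)) _ rfl ?_ Finset.sdiff_disjoint ?_ q ?_
      · exact ⟨u, by simp [mem_nb, hu, h, Finset.disjoint_left.1 hd.2 hu]⟩
      · intro x y hxy
        have h1 := he x y hxy
        simp only [Finset.mem_union, Finset.mem_sdiff, mem_nb, Finset.mem_insert] at h1 ⊢
        by_cases hx : x = v
        · subst hx; tauto
        · by_cases hy : y = v
          · subst hy
            have := hs _ _ hxy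
            tauto
          · tauto
      · rw [← Finset.card_union_of_disjoint Finset.sdiff_disjoint.symm]
        refine le_trans (Finset.card_le_card (t := W ∪ U) ?_)
          ((Finset.card_union_le _ _).trans (by omega))
        intro x
        simp only [Finset.mem_union, Finset.mem_sdiff, mem_nb]
        have := hN x
        tauto
    · apply ih
      · rw [Finset.disjoint_insert_right]
        exact ⟨hv, hd.2⟩
      · intro x y hxy
        have h1 := he x y hxy
        simp only [Finset.mem_insert] at h1 ⊢
        tauto
      · rw [Finset.card_insert_of_notMem hd.1]; omega

end Mono

open MvPolynomial
section SV

/-- The Schmitt-Vogel lemma. -/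
theorem schmitt_vogel {R : Type*} [CommRing R] {ι : Type*} (T : Finset ι) (x : ι → R)
    (l : ι → ℕ) (N : ℕ) (hN : ∀ e ∈ T, l e < N)
    (h : ∀ e ∈ T, ∀ e' ∈ T, e ≠ e' → l e = l e' →
      ∃ e'' ∈ T, l e'' < l e ∧ x e'' ∣ (x e * x e') ^ 2) :
    ∃ f : Fin N → R, (∀ t, f t ∈ Ideal.span (x '' (T : Set ι))) ∧
      (Ideal.span (Set.range f)).radical = (Ideal.span (x '' (T : Set ι))).radical := by
  classical
  let f : Fin N → R := fun t => ∑ e ∈ T.filter (fun e => l e = t), x e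
  have hf : ∀ t, f t ∈ Ideal.span (x '' (T : Set ι)) := by
    intro t
    refine Ideal.sum_mem _ fun e he => Ideal.subset_span ⟨e, ?_, rfl⟩
    exact (Finset.mem_filter.1 he).1
  refine ⟨f, hf, le_antisymm (Ideal.radical_mono (Ideal.span_le.2 ?_)) ?_⟩
  · rintro _ ⟨t, rfl⟩; exact hf t
  rw [Ideal.radical_le_radical_iff, Ideal.span_le]
  set J := (Ideal.span (Set.range f)).radical with hJ
  have key : ∀ t, ∀ e ∈ T, l e = t → x e ∈ J := by
    intro t
    induction t using Nat.strong_induction_on with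
    | _ t ih =>
    intro e he hl
    have hrad : ∀ (y : R) (m : ℕ), y ^ m ∈ J → y ∈ J := by
      intro y m hy
      rw [hJ, ← Ideal.radical_idem]
      exact ⟨m, hy⟩
    apply hrad _ 2
    have ht : t < N := hl ▸ hN e he
    have h1 : x e * f ⟨t, ht⟩ ∈ J :=
      Ideal.mul_mem_left _ _ (Ideal.le_radical (Ideal.subset_span ⟨_, rfl⟩))
    have hem : e ∈ T.filter (fun e => l e = t) := Finset.mem_filter.2 ⟨he, hl⟩
    have h2 : x e * f ⟨t, ht⟩ = x e ^ 2 +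
        ∑ e' ∈ (T.filter (fun e => l e = t)).erase e, x e * x e' := by
      simp only [f]
      rw [← Finset.add_sum_erase _ _ hem, mul_add, Finset.mul_sum, sq]
    have h3 : ∑ e' ∈ (T.filter (fun e => l e = t)).erase e, x e * x e' ∈ J := by
      refine Ideal.sum_mem _ fun e' he' => ?_
      obtain ⟨hne, he'⟩ := Finset.mem_erase.1 he'
      obtain ⟨heT, hl'⟩ := Finset.mem_filter.1 he'
      obtain ⟨e'', h4, h5, h6⟩ := h e he e' heT hne.symm (hl.trans hl'.symm)
      exact hrad _ 2 (Ideal.mem_of_dvd _ h6 (ih _ (hl ▸ h5) e'' h4 rfl))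
    rw [h2] at h1
    exact (Ideal.add_mem_iff_left _ h3).1 h1
  rintro _ ⟨e, he, rfl⟩
  exact key _ e he rfl

variable {k : Type u} [Field k] {n : ℕ}

/-- Generators of `eI`: edges avoiding `W` and variables in `W`. -/
def gen (e : Fin n → Fin n → Prop) (W : Finset (Fin n)) (a b : Fin n) : Prop :=
  (a < b ∧ e a b ∧ a ∉ W ∧ b ∉ W) ∨ (a = b ∧ a ∈ W)

/-- `eI` can be generated up to radical by `N` elements. -/
def ARA (k : Type u) [Field k] {n : ℕ} (e : Fin n → Fin n → Prop) (W : Finset (Fin n)) (N : ℕ) :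
    Prop :=
  ∃ f : Fin N → MvPolynomial (Fin n) k, (∀ t, f t ∈ eI k e W) ∧
      (Ideal.span (Set.range f)).radical = (eI k e W).radical

theorem sv_eI {e : Fin n → Fin n → Prop} (hs : ∀ a b, e a b → e b a) (hi : ∀ a, ¬ e a a)
    (W : Finset (Fin n)) (l : Fin n → Fin n → ℕ) (N : ℕ)
    (hN : ∀ a b, gen e W a b → l a b < N)
    (h : ∀ a b a' b', gen e W a b → gen e W a' b' → ¬ (a = a' ∧ b = b') → l a b = l a' b' →
      ∃ c d, gen e W c d ∧ l c d < l a b ∧ (c = a ∨ c = b ∨ c = a' ∨ c = b') ∧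
        (d = a ∨ d = b ∨ d = a' ∨ d = b')) : ARA k e W N := by
  classical
  let T : Finset (Fin n × Fin n) := Finset.univ.filter (fun p => gen e W p.1 p.2)
  have hT : ∀ a b, (a, b) ∈ T ↔ gen e W a b := fun a b => by simp [T]
  let x : Fin n × Fin n → MvPolynomial (Fin n) k :=
    fun p => if p.1 = p.2 then X p.1 else X p.1 * X p.2
  have hx1 : ∀ a b, X a ∣ x (a, b) ∧ X b ∣ x (a, b) := by
    intro a b
    by_cases hab : a = b
    · subst hab; simp [x]
    · simp [x, hab]
  have hx2 : ∀ a b, x (a, b) ∣ X a * X b := by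
    intro a b
    by_cases hab : a = b
    · subst hab; simp [x]
    · simp [x, hab]
  have hspan : Ideal.span (x '' (T : Set (Fin n × Fin n))) = eI k e W := by
    apply le_antisymm
    · rw [Ideal.span_le]
      rintro _ ⟨⟨a, b⟩, hab, rfl⟩
      rcases (hT a b).1 hab with ⟨h1, h2, -⟩ | ⟨rfl, h2⟩
      · have : x (a, b) = X a * X b := by simp [x, h1.ne]
        rw [SetLike.mem_coe, this]
        exact XX_mem_eI h2
      · have : x (a, a) = X a := by simp [x]
        rw [SetLike.mem_coe, this]
        exact X_mem_eI h2
    · have hW : ∀ a ∈ W, X a ∈ Ideal.span (x '' (T : Set (Fin n × Fin n))) := by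
        intro a ha
        refine Ideal.subset_span ⟨(a, a), (hT a a).2 (Or.inr ⟨rfl, ha⟩), by simp [x]⟩
      refine eI_le_of hi ?_ hW
      intro a b hab
      by_cases ha : a ∈ W
      · exact Ideal.mul_mem_right _ _ (hW a ha)
      by_cases hb : b ∈ W
      · exact Ideal.mul_mem_left _ _ (hW b hb)
      rcases lt_trichotomy a b with hlt | rfl | hlt
      · exact Ideal.subset_span ⟨(a, b), (hT a b).2 (Or.inl ⟨hlt, hab, ha, hb⟩),
          by simp [x, hlt.ne]⟩
      · exact absurd hab (hi _)
      · exact Ideal.subset_span ⟨(b, a), (hT b a).2 (Or.inl ⟨hlt, hs _ _ hab, hb, ha⟩),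
          by simp [x, hlt.ne, mul_comm]⟩
  have := schmitt_vogel T x (fun p => l p.1 p.2) N (by
    rintro ⟨a, b⟩ hab
    exact hN a b ((hT a b).1 hab)) (by
    rintro ⟨a, b⟩ hab ⟨a', b'⟩ hab' hne hl
    obtain ⟨c, d, h1, h2, h3, h4⟩ := h a b a' b' ((hT a b).1 hab) ((hT a' b').1 hab')
      (by rintro ⟨rfl, rfl⟩; exact hne rfl) hl
    refine ⟨(c, d), (hT c d).2 h1, h2, (hx2 c d).trans ?_⟩
    have hdv : ∀ c, (c = a ∨ c = b ∨ c = a' ∨ c = b') → X c ∣ x (a, b) * x (a', b') := by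
      rintro c (rfl | rfl | rfl | rfl)
      · exact ((hx1 _ _).1).mul_right _
      · exact ((hx1 _ _).2).mul_right _
      · exact ((hx1 _ _).1).mul_left _
      · exact ((hx1 _ _).2).mul_left _
    rw [sq]
    exact mul_dvd_mul (hdv c h3) (hdv d h4))
  rw [hspan] at this
  exact this

/-- The two conditions used in the lower bounds. -/
theorem ExG_of_ARA (C : InjRes (MvPolynomial (Fin n) k)) {e : Fin n → Fin n → Prop}
    {W : Finset (Fin n)} {N : ℕ} (h : ARA k e W N) : ExG C (eI k e W) N := by
  obtain ⟨f, -, hf⟩ := h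
  exact ExG_of_ara C _ f hf

theorem ExA_of_EFR (C : InjRes (MvPolynomial (Fin n) k)) {e : Fin n → Fin n → Prop}
    {W : Finset (Fin n)} {N : ℕ} (h : EFR k e W N) : ExA C (eI k e W) N :=
  ExA_of_FR C _ _ h

theorem gen_pair_iff (L : Set (Finset (Fin n))) (e : Fin n → Fin n → Prop) (hi : ∀ a, ¬ e a a)
    (h1 : ∀ F ∈ L, ∃ a b, e a b ∧ F = {a, b}) (h2 : ∀ a b, e a b → {a, b} ∈ L) :
    sqIdeal n k L = eI k e ∅ := by
  apply le_antisymm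
  · rw [sqIdeal, Ideal.span_le]
    rintro _ ⟨F, hF, rfl⟩
    obtain ⟨a, b, hab, rfl⟩ := h1 F hF
    have hne : a ≠ b := by rintro rfl; exact hi _ hab
    simp only [sqMon, Finset.prod_pair hne]
    exact XX_mem_eI hab
  · apply eI_le_of hi
    · intro a b hab
      have hne : a ≠ b := by rintro rfl; exact hi _ hab
      refine Ideal.subset_span ⟨_, h2 a b hab, ?_⟩
      simp only [sqMon, Finset.prod_pair hne]
    · simp

end SV

open MvPolynomial
section Lower
variable {k : Type u} [Field k] {n : ℕ}

/-- The ideal of variables in `F`. -/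
noncomputable abbrev vI (k : Type u) [Field k] {n : ℕ} (F : Finset (Fin n)) :
    Ideal (MvPolynomial (Fin n) k) := eI k (fun _ _ => False) F

theorem vI_empty : vI k (∅ : Finset (Fin n)) = ⊥ := by
  rw [eq_bot_iff]
  exact eI_le_of (by simp) (by simp) (by simp)

theorem RegL_vars (l : List (Fin n)) : ∀ W : Finset (Fin n), l.Nodup → (∀ a ∈ l, a ∉ W) →
    RegL (vI k W) (l.map X) := by
  induction l with
  | nil => intro W _ _; trivial
  | cons v l ih =>
    intro W hl hW
    have hN : W ∪ nb (fun _ _ : Fin n => False) v = W := by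
      ext; simp [mem_nb]
    have hv : v ∉ W := hW v (by simp)
    have hc := eI_colon (k := k) (e := fun _ _ : Fin n => False) (by simp) (by simp) hv
    rw [hN] at hc
    refine ⟨fun s hs => (hc s).1 hs, ?_⟩
    rw [← eI_insert (by simp)]
    rw [List.nodup_cons] at hl
    refine ih _ hl.2 ?_
    intro a ha
    rw [Finset.mem_insert, not_or]
    exact ⟨by rintro rfl; exact hl.1 ha, hW a (by simp [ha])⟩

theorem not_mem_powId (F : Finset (Fin n)) (t N : ℕ) :
    (∏ i ∈ Fᶜ, (X i : MvPolynomial (Fin n) k)) ^ t * (F.toList.map X).prod ^ N ∉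
      powId (F.toList.map X) N := by
  classical
  let m : Fin n →₀ ℕ := Finsupp.equivFunOnFinite.symm (fun i => if i ∈ F then N else t)
  have hm : ∀ i ∈ F, m i = N := fun i hi => by simp [m, hi]
  have e1 : (∏ i ∈ Fᶜ, (X i : MvPolynomial (Fin n) k)) ^ t * (F.toList.map X).prod ^ N
      = monomial m 1 := by
    rw [Finset.prod_map_toList, monomial_eq, C_1, one_mul, Finsupp.prod_fintype _ _ (by simp),
      ← Finset.prod_mul_prod_compl F, mul_comm, ← Finset.prod_pow, ← Finset.prod_pow]
    congr 1
    · exact Finset.prod_congr rfl fun i hi => by rw [hm i hi]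
    · exact Finset.prod_congr rfl fun i hi => by simp [m, Finset.mem_compl.1 hi]
  have e2 : powId (F.toList.map (X : Fin n → MvPolynomial (Fin n) k)) N =
      Ideal.span ((fun m : Fin n →₀ ℕ => monomial m (1 : k)) ''
        ((fun i => Finsupp.single i (N + 1)) '' (F : Set (Fin n)))) := by
    rw [powId]
    congr 1
    ext p
    simp [X_pow_eq_monomial]
  rw [e1, e2, mem_ideal_span_monomial_image]
  intro h
  obtain ⟨_, ⟨i, hi, rfl⟩, hle⟩ := h m (by simp [support_monomial])
  have := hle i
  rw [hm i hi] at this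
  simp at this

theorem nonvan_vars (C : InjRes (MvPolynomial (Fin n) k)) (F : Finset (Fin n)) (c : ℕ)
    (hc : F.card = c + 1) :
    ∃ z' : C.E (c + 1), z' ∈ Ann (vI k F) (C.E (c + 1)) ∧ C.d _ z' = 0 ∧
      ∀ t : ℕ, ∀ b ∈ Gam (vI k F) (C.E c),
        C.d c b ≠ ((∏ i ∈ Fᶜ, (X i : MvPolynomial (Fin n) k)) ^ t) • z' := by
  classical
  have hlen : (F.toList.map (X : Fin n → MvPolynomial (Fin n) k)).length = c + 1 := by simp [hc]
  have hspan : Ideal.span {x | x ∈ F.toList.map (X : Fin n → MvPolynomial (Fin n) k)}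
      = vI k F := by
    apply le_antisymm
    · rw [Ideal.span_le]
      intro x hx
      obtain ⟨i, hi, rfl⟩ := List.mem_map.1 hx
      exact X_mem_eI (by simpa using hi)
    · apply eI_le_of (by simp) (by simp)
      intro a ha
      exact Ideal.subset_span (List.mem_map.2 ⟨a, by simpa using ha, rfl⟩)
  have hR : RegL (⊥ : Ideal (MvPolynomial (Fin n) k)) (F.toList.map X) := by
    rw [← vI_empty]
    exact RegL_vars _ _ F.nodup_toList (by simp)
  have hG := not_mem_powId (k := k) F
  revert hlen hspan hR hG
  generalize F.toList.map (X : Fin n → MvPolynomial (Fin n) k) = L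
  intro hlen hspan hR hG
  cases L with
  | nil => simp at hlen
  | cons y l =>
    simp only [List.length_cons, Nat.add_right_cancel_iff] at hlen
    subst hlen
    obtain ⟨z', h1, h2, h3⟩ := nonvanishing C
      (Set.range fun t : ℕ => (∏ i ∈ Fᶜ, (X i : MvPolynomial (Fin n) k)) ^ t) y l hR (by
        rintro _ ⟨t, rfl⟩ N
        exact hG t N)
    rw [hspan] at h1 h3
    exact ⟨z', h1, h2, fun t b hb => h3 _ ⟨t, rfl⟩ b hb⟩

/-- Weak exactness. -/
def ExW {R : Type u} [CommRing R] (C : InjRes R) (J : Ideal R) (p : ℕ) : Prop :=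
  ∀ i, p ≤ i → ∀ z ∈ Ann J (C.E (i + 1)), C.d (i + 1) z = 0 → ∃ w ∈ Gam J (C.E i), C.d i w = z

theorem ExW_of_ExG {R : Type u} [CommRing R] {C : InjRes R} {J : Ideal R} {p : ℕ}
    (h : ExG C J p) : ExW C J p := fun i hi z hz => h i hi z (Ann_le_Gam _ hz)

theorem ExW_of_ExA {R : Type u} [CommRing R] {C : InjRes R} {J : Ideal R} {p : ℕ}
    (h : ExA C J p) : ExW C J p := fun i hi z hz hd => by
  obtain ⟨w, hw, h1⟩ := h i hi z hz hd
  exact ⟨w, Ann_le_Gam _ hw, h1⟩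

theorem Gam_shift {R : Type u} [CommRing R] {M : Type*} [AddCommGroup M] [Module R M]
    {P I : Ideal R} {g : R} (h : ∀ a ∈ P, a * g ∈ I) {w : M} (hw : w ∈ Gam I M) :
    ∃ t : ℕ, g ^ t • w ∈ Gam P M := by
  obtain ⟨t, ht⟩ := mem_Gam.1 hw
  have hgP : P * Ideal.span {g} ≤ I := by
    rw [Ideal.mul_le]
    intro r hr s hs
    obtain ⟨s, rfl⟩ := Ideal.mem_span_singleton'.1 hs
    rw [mul_left_comm]
    exact Ideal.mul_mem_left _ _ (h r hr)
  refine ⟨t, mem_Gam.2 ⟨t, fun a ha => ?_⟩⟩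
  have h1 : g ^ t ∈ Ideal.span {g} ^ t := Ideal.pow_mem_pow (Ideal.mem_span_singleton_self g) t
  have h2 : a * g ^ t ∈ P ^ t * Ideal.span {g} ^ t := Ideal.mul_mem_mul ha h1
  rw [← mul_pow] at h2
  have h3 := ht (a * g ^ t) (Ideal.pow_right_mono hgP t h2)
  rw [smul_smul, h3]

/-- Multiplication by `g` pulls back ideals. -/
def mulComap {R : Type u} [CommRing R] (g : R) (I : Ideal R) : Ideal R :=
  Submodule.comap (LinearMap.mulRight R g) I

theorem mem_mulComap {R : Type u} [CommRing R] {g a : R} {I : Ideal R} :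
    a ∈ mulComap g I ↔ a * g ∈ I := Iff.rfl

theorem F_bound (C : InjRes (MvPolynomial (Fin n) k)) {e : Fin n → Fin n → Prop}
    (F : Finset (Fin n)) (hcov : ∀ a b, e a b → a ∈ F ∨ b ∈ F)
    (hadj : ∀ a ∈ F, ∃ b, b ∉ F ∧ e a b) {N : ℕ} (h : ExW C (eI k e ∅) N) : F.card ≤ N := by
  by_contra hlt
  obtain ⟨c, hc⟩ : ∃ c, F.card = c + 1 := ⟨F.card - 1, by omega⟩
  obtain ⟨z, h1, h2, h3⟩ := nonvan_vars C F c hc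
  have hle : eI k e ∅ ≤ vI k F := eI_mono (fun a b h => Or.inr (hcov a b h)) (by simp)
  obtain ⟨w, hw, hdw⟩ := h c (by omega) z (Ann_anti hle h1) h2
  have hgP : ∀ a ∈ vI k F, a * (∏ i ∈ Fᶜ, (X i : MvPolynomial (Fin n) k)) ∈ eI k e ∅ := by
    have : vI k F ≤ mulComap (∏ i ∈ Fᶜ, (X i : MvPolynomial (Fin n) k)) (eI k e ∅) := by
      apply eI_le_of (by simp) (by simp)
      intro a ha
      obtain ⟨b, hb, hab⟩ := hadj a ha
      rw [mem_mulComap]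
      have hd : X b ∣ ∏ i ∈ Fᶜ, (X i : MvPolynomial (Fin n) k) :=
        Finset.dvd_prod_of_mem _ (Finset.mem_compl.2 hb)
      exact Ideal.mem_of_dvd _ (mul_dvd_mul_left (X a) hd) (XX_mem_eI hab)
    exact fun a ha => mem_mulComap.1 (this ha)
  obtain ⟨t, ht⟩ := Gam_shift hgP hw
  exact h3 t _ ht (by rw [map_smul, hdw])

theorem disc_setup {e : Fin n → Fin n → Prop} {A B : Finset (Fin n)}
    (hAB : ∀ a ∈ A, ∀ b ∈ B, e a b)
    (he : ∀ a b, e a b → a ∈ A ∪ B ∧ b ∈ A ∪ B) :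
    eI k e ∅ ≤ eI k e B ∧ eI k e ∅ ≤ eI k e A ∧ eI k e B ⊓ eI k e A ≤ eI k e ∅ ∧
      eI k e B ⊔ eI k e A = vI k (A ∪ B) := by
  refine ⟨eI_mono (fun _ _ h => Or.inl h) (by simp), eI_mono (fun _ _ h => Or.inl h) (by simp),
    ?_, le_antisymm (sup_le ?_ ?_) ?_⟩
  · rintro p ⟨h1, h2⟩
    rw [SetLike.mem_coe, mem_eI] at h1 h2
    rw [mem_eI]
    intro m hm
    left
    rcases h1 m hm with h | ⟨b, hb, hb'⟩
    · exact h
    rcases h2 m hm with h | ⟨a, ha, ha'⟩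
    · exact h
    exact ⟨a, b, hAB a ha b hb, ha', hb'⟩
  · exact eI_mono (fun a b h => Or.inr (Or.inl (he a b h).1)) Finset.subset_union_right
  · exact eI_mono (fun a b h => Or.inr (Or.inl (he a b h).1)) Finset.subset_union_left
  · apply eI_le_of (by simp) (by simp)
    intro a ha
    rcases Finset.mem_union.1 ha with ha | ha
    · exact Ideal.mem_sup_right (X_mem_eI ha)
    · exact Ideal.mem_sup_left (X_mem_eI ha)

theorem disc_bound_ARA (C : InjRes (MvPolynomial (Fin n) k)) {e : Fin n → Fin n → Prop}
    {A B : Finset (Fin n)} (hAB : ∀ a ∈ A, ∀ b ∈ B, e a b)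
    (he : ∀ a b, e a b → a ∈ A ∪ B ∧ b ∈ A ∪ B) {m : ℕ} (hm : (A ∪ B).card = m + 2)
    (hA : ARA k e A (m + 1)) (hB : ARA k e B (m + 1)) {N : ℕ} (h : ARA k e ∅ N) : m + 1 ≤ N := by
  by_contra hlt
  obtain ⟨h1, h2, h3, h4⟩ := disc_setup (k := k) hAB he
  obtain ⟨z, hz, hdz, hn⟩ := nonvan_vars C (A ∪ B) (m + 1) hm
  rw [← h4] at hz hn
  obtain ⟨w, hw, hdw⟩ := mv_Gam h1 h2 h3 (ExG_of_ARA C hB) (ExG_of_ARA C hA)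
    (ExG_mono (by omega) (ExG_of_ARA C h)) z (Ann_le_Gam _ hz) hdz
  exact hn 0 w hw (by rw [hdw, pow_zero, one_smul])

theorem disc_bound_EFR (C : InjRes (MvPolynomial (Fin n) k)) {e : Fin n → Fin n → Prop}
    {A B : Finset (Fin n)} (hAB : ∀ a ∈ A, ∀ b ∈ B, e a b)
    (he : ∀ a b, e a b → a ∈ A ∪ B ∧ b ∈ A ∪ B) {m : ℕ} (hm : (A ∪ B).card = m + 2)
    (hA : EFR k e A (m + 1)) (hB : EFR k e B (m + 1)) {N : ℕ} (h : EFR k e ∅ N) : m + 1 ≤ N := by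
  by_contra hlt
  obtain ⟨h1, h2, h3, h4⟩ := disc_setup (k := k) hAB he
  obtain ⟨z, hz, hdz, hn⟩ := nonvan_vars C (A ∪ B) (m + 1) hm
  rw [← h4] at hz hn
  obtain ⟨w, hw, hdw⟩ := mv_Ann h1 h2 h3 (ExA_of_EFR C hB) (ExA_of_EFR C hA)
    (ExA_of_EFR C (EFR_mono (show N ≤ m by omega) h)) z hz hdz
  exact hn 0 w hw (by rw [hdw, pow_zero, one_smul])

/-- If matching bounds are available, the two invariants agree. -/
theorem final_eq {e : Fin n → Fin n → Prop} {N : ℕ} (h1 : ARA k e ∅ N) (h2 : EFR k e ∅ N)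
    (h3 : ∀ M, ARA k e ∅ M → N ≤ M) (h4 : ∀ M, EFR k e ∅ M → N ≤ M) :
    araI (eI k e ∅) = pdQ (eI k e ∅) := by
  have e1 : araI (eI k e ∅) = N := le_antisymm (Nat.sInf_le h1) (le_csInf ⟨N, h1⟩ fun M hM => h3 M hM)
  have hb : ∀ M, EFR k e ∅ M ↔ PdBound (eI k e ∅) M :=
    fun M => ⟨fun h => Res_of_FR M h, fun h => FR_of_Res M h⟩
  have e2 : pdQ (eI k e ∅) = N := le_antisymm (Nat.sInf_le ((hb N).1 h2))
    (le_csInf ⟨N, (hb N).1 h2⟩ fun M hM => h4 M ((hb M).2 hM))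
  rw [e1, e2]

theorem final_F {e : Fin n → Fin n → Prop} (F : Finset (Fin n))
    (hcov : ∀ a b, e a b → a ∈ F ∨ b ∈ F) (hadj : ∀ a ∈ F, ∃ b, b ∉ F ∧ e a b)
    {N : ℕ} (hN : F.card = N) (h1 : ARA k e ∅ N) (h2 : EFR k e ∅ N) :
    araI (eI k e ∅) = pdQ (eI k e ∅) := by
  subst hN
  exact final_eq h1 h2
    (fun M h => F_bound (injRes _) F hcov hadj (ExW_of_ExG (ExG_of_ARA _ h)))
    (fun M h => F_bound (injRes _) F hcov hadj (ExW_of_ExA (ExA_of_EFR _ h)))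

end Lower

/-- Edges of the lexsegment graph (for `p < q`). -/
def E0 (s i j r p q : ℕ) : Prop := (s < p ∨ (p = s ∧ i ≤ q)) ∧ (p < j ∨ (p = j ∧ q ≤ r))

/-- First level function. -/
def lev1 (n s i j p q : ℕ) : ℕ :=
  if p = s then (if j + 1 ≤ q then q - s - 2 else n - s - 2)
  else if p < j then (if q < j then q - s - 2 else if q = j then n - s - 3 else q - s - 3)
  else (if q < i then q - s - 2 else q - s - 1)

theorem lev1_cls {n s i j r t a b : ℕ} (hsi : s < i) (hjr : j < r) (hrn : r < n)
    (hsj : s < j) (hab : a < b) (_hb : b < n) (he : E0 s i j r a b) (hl : lev1 n s i j a b = t) :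
    (a = s ∧ i ≤ b ∧ j + 1 ≤ b ∧ t + s + 2 = b) ∨ (a = s ∧ i ≤ b ∧ b ≤ j ∧ t + s + 2 = n) ∨
    (s < a ∧ a < j ∧ b < j ∧ t + s + 2 = b) ∨ (s < a ∧ a < j ∧ b = j ∧ t + s + 3 = n) ∨
    (s < a ∧ a < j ∧ j < b ∧ t + s + 3 = b) ∨ (a = j ∧ b ≤ r ∧ b < i ∧ t + s + 2 = b) ∨
    (a = j ∧ b ≤ r ∧ i ≤ b ∧ t + s + 1 = b) := by
  obtain ⟨he1, he2⟩ := he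
  unfold lev1 at hl
  by_cases c1 : a = s
  · have : i ≤ b := by rcases he1 with h | h <;> omega
    rw [if_pos c1] at hl
    by_cases c2 : j + 1 ≤ b
    · rw [if_pos c2] at hl; left; omega
    · rw [if_neg c2] at hl; right; left; omega
  rw [if_neg c1] at hl
  have h3 : s < a := by rcases he1 with h | h <;> omega
  by_cases c2 : a < j
  · rw [if_pos c2] at hl
    by_cases c3 : b < j
    · rw [if_pos c3] at hl; right; right; left; omega
    rw [if_neg c3] at hl
    by_cases c4 : b = j
    · rw [if_pos c4] at hl; right; right; right; left; omega
    · rw [if_neg c4] at hl; right; right; right; right; left; omega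
  rw [if_neg c2] at hl
  have h4 : a = j ∧ b ≤ r := by rcases he2 with h | h <;> omega
  by_cases c3 : b < i
  · rw [if_pos c3] at hl; right; right; right; right; right; left; omega
  · rw [if_neg c3] at hl; right; right; right; right; right; right; omega

set_option maxHeartbeats 4000000 in
theorem lev1_sv {n s i j r : ℕ} (hsi : s < i) (hjr : j < r) (hrn : r < n)
    (hsj : s < j) (h2 : r + 1 = n → i ≤ j + 1)
    (a b a' b' : ℕ) (hab : a < b) (hb : b < n) (he : E0 s i j r a b)
    (hab' : a' < b') (hb' : b' < n) (he' : E0 s i j r a' b') (hne : ¬ (a = a' ∧ b = b'))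
    (hl : lev1 n s i j a b = lev1 n s i j a' b') :
    ∃ c d, (c < d ∧ E0 s i j r c d) ∧ lev1 n s i j c d < lev1 n s i j a b ∧
      (c = a ∨ c = b ∨ c = a' ∨ c = b') ∧ (d = a ∨ d = b ∨ d = a' ∨ d = b') := by
  have h' := lev1_cls hsi hjr hrn hsj hab' hb' he' hl.symm
  have h := lev1_cls hsi hjr hrn hsj hab hb he rfl
  generalize lev1 n s i j a b = t at h h' ⊢
  clear hl he he'
  have kA : ∀ c d, ((c = a ∨ c = b ∨ c = a' ∨ c = b') ∧ (d = a ∨ d = b ∨ d = a' ∨ d = b')) →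
     (c = s ∧ i ≤ d ∧ j < d ∧ d < t + s + 2) →
     ∃ c d, (c < d ∧ E0 s i j r c d) ∧ lev1 n s i j c d < t ∧
      (c = a ∨ c = b ∨ c = a' ∨ c = b') ∧ (d = a ∨ d = b ∨ d = a' ∨ d = b') := by
    rintro c d h ⟨h1, h2, h3, h4⟩
    refine ⟨c, d, ⟨by omega, Or.inr ⟨h1, h2⟩, by omega⟩, ?_, h⟩
    unfold lev1
    rw [if_pos h1, if_pos (by omega)]
    omega
  have kB : ∀ c d, ((c = a ∨ c = b ∨ c = a' ∨ c = b') ∧ (d = a ∨ d = b ∨ d = a' ∨ d = b')) →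
     (s < c ∧ c < d ∧ d < j ∧ d < t + s + 2) →
     ∃ c d, (c < d ∧ E0 s i j r c d) ∧ lev1 n s i j c d < t ∧
      (c = a ∨ c = b ∨ c = a' ∨ c = b') ∧ (d = a ∨ d = b ∨ d = a' ∨ d = b') := by
    rintro c d h ⟨h1, h2, h3, h4⟩
    refine ⟨c, d, ⟨by omega, Or.inl h1, Or.inl (by omega)⟩, ?_, h⟩
    unfold lev1
    rw [if_neg (by omega), if_pos (by omega), if_pos h3]
    omega
  have kC : ∀ c d, ((c = a ∨ c = b ∨ c = a' ∨ c = b') ∧ (d = a ∨ d = b ∨ d = a' ∨ d = b')) →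
     (s < c ∧ c < j ∧ d = j ∧ n < t + s + 3) →
     ∃ c d, (c < d ∧ E0 s i j r c d) ∧ lev1 n s i j c d < t ∧
      (c = a ∨ c = b ∨ c = a' ∨ c = b') ∧ (d = a ∨ d = b ∨ d = a' ∨ d = b') := by
    rintro c d h ⟨h1, h2, h3, h4⟩
    refine ⟨c, d, ⟨by omega, Or.inl h1, Or.inl (by omega)⟩, ?_, h⟩
    unfold lev1
    rw [if_neg (by omega), if_pos (by omega), if_neg (by omega), if_pos h3]
    omega
  have kD : ∀ c d, ((c = a ∨ c = b ∨ c = a' ∨ c = b') ∧ (d = a ∨ d = b ∨ d = a' ∨ d = b')) →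
     (s < c ∧ c < j ∧ j < d ∧ d < t + s + 3) →
     ∃ c d, (c < d ∧ E0 s i j r c d) ∧ lev1 n s i j c d < t ∧
      (c = a ∨ c = b ∨ c = a' ∨ c = b') ∧ (d = a ∨ d = b ∨ d = a' ∨ d = b') := by
    rintro c d h ⟨h1, h2, h3, h4⟩
    refine ⟨c, d, ⟨by omega, Or.inl h1, Or.inl (by omega)⟩, ?_, h⟩
    unfold lev1
    rw [if_neg (by omega), if_pos (by omega), if_neg (by omega), if_neg (by omega)]
    omega
  rcases h with h | h | h | h | h | h | h <;> rcases h' with h' | h' | h' | h' | h' | h' | h'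
  all_goals first
    | (exfalso; clear kA kB kC kD; omega)
    | (refine kA a b' ⟨by simp, by simp⟩ ?_; omega)
    | (refine kA a' b ⟨by simp, by simp⟩ ?_; omega)
    | (refine kD a b' ⟨by simp, by simp⟩ ?_; omega)
    | (refine kD a' b ⟨by simp, by simp⟩ ?_; omega)
    | (have hx : a < a' ∨ a' < a := by omega
       rcases hx with hlt | hlt
       · refine kB a a' ⟨by simp, by simp⟩ ?_; omega
       · refine kB a' a ⟨by simp, by simp⟩ ?_; omega)
    | (have hx : b < b' ∨ b' < b := by omega
       rcases hx with hlt | hlt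
       · rcases Nat.lt_or_ge b' j with hj | hj
         · refine kB b b' ⟨by simp, by simp⟩ ?_; omega
         · refine kC b b' ⟨by simp, by simp⟩ ?_; omega
       · rcases Nat.lt_or_ge b j with hj | hj
         · refine kB b' b ⟨by simp, by simp⟩ ?_; omega
         · refine kC b' b ⟨by simp, by simp⟩ ?_; omega)

theorem lev1_lt {n s i j r : ℕ} (hsi : s < i) (hjr : j < r) (hrn : r < n)
    (hsj : s < j) (N : ℕ) (hN : n ≤ N + s + 2)
    (hN' : i ≤ j ∨ r + 1 = n → n ≤ N + s + 1)
    (a b : ℕ) (hab : a < b) (hb : b < n) (he : E0 s i j r a b) : lev1 n s i j a b < N := by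
  have h := lev1_cls hsi hjr hrn hsj hab hb he rfl
  generalize lev1 n s i j a b = t at h ⊢
  rcases h with h | h | h | h | h | h | h <;> omega

/-- Second level function. -/
def lev2 (n s i j p q : ℕ) : ℕ :=
  if p = s then j - s + (q - i)
  else if q ≤ j then q - s - 2 else if i ≤ q then j - s - 1 + (q - i)
  else j - s - 1 + (n - i) + (q - j - 1)

theorem lev2_cls {n s i j r t a b : ℕ} (hin : i < n)
    (hsj : s < j) (hab : a < b) (he : E0 s i j r a b) (hl : lev2 n s i j a b = t) :
    (a = s ∧ i ≤ b ∧ t + s + i = j + b) ∨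
    (s < a ∧ a < j ∧ b ≤ j ∧ t + s + 2 = b) ∨
    (s < a ∧ a ≤ j ∧ j < b ∧ i ≤ b ∧ t + s + 1 + i = j + b) ∨
    (s < a ∧ a ≤ j ∧ j < b ∧ b < i ∧ t + s + 2 + i = n + b) := by
  obtain ⟨he1, he2⟩ := he
  unfold lev2 at hl
  by_cases c1 : a = s
  · rw [if_pos c1] at hl
    have : i ≤ b := by rcases he1 with h | h <;> omega
    left; omega
  rw [if_neg c1] at hl
  have h3 : s < a := by rcases he1 with h | h <;> omega
  have h4 : a ≤ j := by rcases he2 with h | h <;> omega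
  by_cases c2 : b ≤ j
  · rw [if_pos c2] at hl
    right; left; omega
  rw [if_neg c2] at hl
  by_cases c3 : i ≤ b
  · rw [if_pos c3] at hl
    right; right; left; omega
  · rw [if_neg c3] at hl
    right; right; right; omega

theorem lev2_lt {n s i j r : ℕ} (hin : i < n)
    (hsj : s < j) (h2 : j + 2 ≤ i) (N : ℕ) (hN : n = N + s + 2)
    (a b : ℕ) (hab : a < b) (hb : b < n) (he : E0 s i j r a b) : lev2 n s i j a b < N := by
  have h := lev2_cls hin hsj hab he rfl
  generalize lev2 n s i j a b = t at h ⊢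
  rcases h with h | h | h | h <;> omega

set_option maxHeartbeats 1000000 in
theorem lev2_sv {n s i j r : ℕ} (hin : i < n) (hrn : r + 1 = n)
    (hsj : s < j) (h2 : j + 2 ≤ i)
    (a b a' b' : ℕ) (hab : a < b) (hb : b < n) (he : E0 s i j r a b)
    (hab' : a' < b') (hb' : b' < n) (he' : E0 s i j r a' b') (hne : ¬ (a = a' ∧ b = b'))
    (hl : lev2 n s i j a b = lev2 n s i j a' b') :
    ∃ c d, (c < d ∧ E0 s i j r c d) ∧ lev2 n s i j c d < lev2 n s i j a b ∧
      (c = a ∨ c = b ∨ c = a' ∨ c = b') ∧ (d = a ∨ d = b ∨ d = a' ∨ d = b') := by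
  have h' := lev2_cls hin hsj hab' he' hl.symm
  have h := lev2_cls hin hsj hab he rfl
  generalize lev2 n s i j a b = t at h h' ⊢
  clear hl he he'
  have kP : ∀ c d, ((c = a ∨ c = b ∨ c = a' ∨ c = b') ∧ (d = a ∨ d = b ∨ d = a' ∨ d = b')) →
     (s < c ∧ c < d ∧ d ≤ j ∧ d < t + s + 2) →
     ∃ c d, (c < d ∧ E0 s i j r c d) ∧ lev2 n s i j c d < t ∧
      (c = a ∨ c = b ∨ c = a' ∨ c = b') ∧ (d = a ∨ d = b ∨ d = a' ∨ d = b') := by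
    rintro c d h ⟨h1, h2, h3, h4⟩
    refine ⟨c, d, ⟨by omega, Or.inl h1, Or.inl (by omega)⟩, ?_, h⟩
    unfold lev2
    rw [if_neg (by omega), if_pos (by omega)]
    omega
  have kX : ∀ c d, ((c = a ∨ c = b ∨ c = a' ∨ c = b') ∧ (d = a ∨ d = b ∨ d = a' ∨ d = b')) →
     (s < c ∧ c ≤ j ∧ i ≤ d ∧ d < n ∧ d + j < t + s + i + 1) →
     ∃ c d, (c < d ∧ E0 s i j r c d) ∧ lev2 n s i j c d < t ∧
      (c = a ∨ c = b ∨ c = a' ∨ c = b') ∧ (d = a ∨ d = b ∨ d = a' ∨ d = b') := by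
    rintro c d h ⟨h1, h2, h3, h4, h5⟩
    refine ⟨c, d, ⟨by omega, Or.inl h1, by omega⟩, ?_, h⟩
    unfold lev2
    rw [if_neg (by omega), if_neg (by omega), if_pos h3]
    omega
  rcases h with h | h | h | h <;> rcases h' with h' | h' | h' | h'
  all_goals first
    | (exfalso; clear kP kX; omega)
    | (refine kX a b' ⟨by simp, by simp⟩ ?_; omega)
    | (refine kX a' b ⟨by simp, by simp⟩ ?_; omega)
    | (have hx : a < a' ∨ a' < a := by omega
       rcases hx with hlt | hlt
       · refine kP a a' ⟨by simp, by simp⟩ ?_; omega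
       · refine kP a' a ⟨by simp, by simp⟩ ?_; omega)

open MvPolynomial
section Comb2
variable {k : Type u} [Field k] {n : ℕ}

/-- Symmetric edge relation of the lexsegment graph. -/
def ed (s i j r : ℕ) (a b : Fin n) : Prop :=
  (a.1 < b.1 ∧ E0 s i j r a b) ∨ (b.1 < a.1 ∧ E0 s i j r b a)

theorem ed_symm (s i j r : ℕ) : ∀ a b : Fin n, ed s i j r a b → ed s i j r b a :=
  fun _ _ h => h.symm

theorem ed_irr (s i j r : ℕ) : ∀ a : Fin n, ¬ ed s i j r a a := by
  rintro a (h | h) <;> exact lt_irrefl _ h.1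

/-- Interval of indices. -/
def iv (n lo hi : ℕ) : Finset (Fin n) := Finset.univ.filter fun x => lo ≤ x.1 ∧ x.1 < hi

theorem mem_iv {lo hi : ℕ} {x : Fin n} : x ∈ iv n lo hi ↔ lo ≤ x.1 ∧ x.1 < hi := by
  simp [iv]

theorem card_iv {lo hi : ℕ} (h : hi ≤ n) : (iv n lo hi).card = hi - lo := by
  rw [← Nat.card_Ico, ← Finset.card_map Fin.valEmbedding]
  congr 1
  ext x
  simp only [Finset.mem_map, mem_iv, Finset.mem_Ico, Fin.valEmbedding_apply]
  constructor
  · rintro ⟨y, hy, rfl⟩; exact hy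
  · intro hx; exact ⟨⟨x, by omega⟩, hx, rfl⟩

theorem ara_of_lev {s i j r : ℕ} (l : ℕ → ℕ → ℕ) (N : ℕ)
    (hN : ∀ a b, a < b → b < n → E0 s i j r a b → l a b < N)
    (h : ∀ a b a' b', a < b → b < n → E0 s i j r a b → a' < b' → b' < n → E0 s i j r a' b' →
      ¬ (a = a' ∧ b = b') → l a b = l a' b' →
      ∃ c d, (c < d ∧ E0 s i j r c d) ∧ l c d < l a b ∧
      (c = a ∨ c = b ∨ c = a' ∨ c = b') ∧ (d = a ∨ d = b ∨ d = a' ∨ d = b')) :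
    ARA k (ed (n := n) s i j r) ∅ N := by
  have hg : ∀ a b : Fin n, gen (ed s i j r) ∅ a b ↔ (a.1 < b.1 ∧ E0 s i j r a b) := by
    intro a b
    simp only [gen, ed, Finset.notMem_empty, not_false_eq_true, and_true, and_false, or_false,
      Fin.lt_def]
    constructor
    · rintro ⟨h1, h | h⟩
      · exact h
      · omega
    · intro h; exact ⟨h.1, Or.inl h⟩
  refine sv_eI (ed_symm s i j r) (ed_irr s i j r) ∅ (fun a b => l a b) N ?_ ?_
  · intro a b hab
    rw [hg] at hab
    exact hN _ _ hab.1 b.2 hab.2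
  · intro a b a' b' h1 h2 hne hl
    rw [hg] at h1 h2
    obtain ⟨c, d, hcd, hlt, hc, hd⟩ := h a b a' b' h1.1 b.2 h1.2 h2.1 b'.2 h2.2
      (fun hh => hne ⟨Fin.ext hh.1, Fin.ext hh.2⟩) hl
    have hc' : ∃ c' : Fin n, c'.1 = c ∧ (c' = a ∨ c' = b ∨ c' = a' ∨ c' = b') := by
      rcases hc with rfl | rfl | rfl | rfl <;> exact ⟨_, rfl, by simp⟩
    have hd' : ∃ c' : Fin n, c'.1 = d ∧ (c' = a ∨ c' = b ∨ c' = a' ∨ c' = b') := by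
      rcases hd with rfl | rfl | rfl | rfl <;> exact ⟨_, rfl, by simp⟩
    obtain ⟨c', rfl, hc'⟩ := hc'
    obtain ⟨d', rfl, hd'⟩ := hd'
    exact ⟨c', d', (hg _ _).2 hcd, hlt, hc', hd'⟩

theorem case_star {s i r : ℕ} (hsi : s < i) (hir : i ≤ r) (hr : r < n) :
    araI (eI k (ed (n := n) s i s r) ∅) = pdQ (eI k (ed (n := n) s i s r) ∅) := by
  have hsn : s < n := by omega
  have hE : ∀ a b, E0 s i s r a b ↔ (a = s ∧ i ≤ b ∧ b ≤ r) := by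
    intro a b; unfold E0; omega
  have hed : ∀ a b : Fin n, ed s i s r a b → (a.1 = s ∧ i ≤ b.1 ∧ b.1 ≤ r) ∨
      (b.1 = s ∧ i ≤ a.1 ∧ a.1 ≤ r) := by
    rintro a b (h | h)
    · left; exact (hE _ _).1 h.2
    · right; exact (hE _ _).1 h.2
  refine final_F (N := r + 1 - i) (iv n i (r + 1)) ?_ ?_ (card_iv (by omega)) ?_ ?_
  · intro a b hab
    rw [mem_iv, mem_iv]
    rcases hed _ _ hab with h | h <;> omega
  · intro a ha
    rw [mem_iv] at ha
    refine ⟨⟨s, hsn⟩, ?_, Or.inr ⟨by simp only; omega, (hE _ _).2 ⟨rfl, by omega⟩⟩⟩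
    rw [mem_iv]; simp only; omega
  · refine ara_of_lev (fun _ b => b - i) _ ?_ ?_
    · intro a b _ _ h
      rw [hE] at h
      omega
    · intro a b a' b' _ _ h _ _ h' hne hl
      rw [hE] at h h'
      exfalso
      omega
  · refine EFR_split (ed_symm _ _ _ _) (ed_irr _ _ _ _) (v := ⟨s, hsn⟩) (by simp) ?_ ?_
    · refine EFR_cover _ ?_ ?_
      · intro a b hab
        simp only [Finset.empty_union, mem_nb]
        rcases hed _ _ hab with h | h
        · right
          rwa [show (⟨s, hsn⟩ : Fin n) = a from Fin.ext h.1.symm]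
        · left
          rw [show (⟨s, hsn⟩ : Fin n) = b from Fin.ext h.1.symm]
          exact hab.symm
      · rw [← card_iv (n := n) (lo := i) (hi := r + 1) (by omega)]
        apply Finset.card_le_card
        intro x hx
        simp only [Finset.empty_union, mem_nb] at hx
        rw [mem_iv]
        rcases hed _ _ hx with h | h <;> simp only at h <;> omega
    · refine EFR_cover _ ?_ ?_
      · intro a b hab
        simp only [Finset.mem_insert, Fin.ext_iff]
        rcases hed _ _ hab with h | h
        · left; left; exact h.1
        · right; left; exact h.1
      · simp; omega

theorem case_two {s i r : ℕ} (hi : i < n) (hr : s + 1 < r) (hri : r + 1 < i) :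
    araI (eI k (ed (n := n) s i (s + 1) r) ∅) = pdQ (eI k (ed (n := n) s i (s + 1) r) ∅) := by
  have hsn : s < n := by omega
  have hjn : s + 1 < n := by omega
  have hE : ∀ a b, a < b → (E0 s i (s + 1) r a b ↔ (a = s ∧ i ≤ b) ∨ (a = s + 1 ∧ b ≤ r)) := by
    intro a b; unfold E0; omega
  have hed : ∀ a b : Fin n, ed s i (s + 1) r a b →
      (a.1 = s ∧ i ≤ b.1) ∨ (b.1 = s ∧ i ≤ a.1) ∨
      (a.1 = s + 1 ∧ s + 1 < b.1 ∧ b.1 ≤ r) ∨ (b.1 = s + 1 ∧ s + 1 < a.1 ∧ a.1 ≤ r) := by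
    rintro a b (⟨h0, h⟩ | ⟨h0, h⟩) <;> rw [hE _ _ h0] at h <;> omega
  have hed1 : ∀ b : Fin n, i ≤ b.1 → ed s i (s + 1) r ⟨s, hsn⟩ b := fun b hb =>
    Or.inl ⟨by simp only; omega, (hE _ _ (by simp only; omega)).2 (Or.inl ⟨rfl, hb⟩)⟩
  have hed2 : ∀ b : Fin n, s + 1 < b.1 → b.1 ≤ r → ed s i (s + 1) r ⟨s + 1, hjn⟩ b :=
    fun b hb hb' => Or.inl ⟨hb, (hE _ _ hb).2 (Or.inr ⟨rfl, hb'⟩)⟩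
  have hn1 : nb (ed (n := n) s i (s + 1) r) ⟨s, hsn⟩ = iv n i n := by
    ext x
    rw [mem_nb, mem_iv]
    refine ⟨fun h => ?_, fun h => hed1 x h.1⟩
    have := x.2
    rcases hed _ _ h with h | h | h | h <;> simp only at h <;> omega
  have hn2 : nb (ed (n := n) s i (s + 1) r) ⟨s + 1, hjn⟩ = iv n (s + 2) (r + 1) := by
    ext x
    rw [mem_nb, mem_iv]
    refine ⟨fun h => ?_, fun h => hed2 x (by omega) (by omega)⟩
    rcases hed _ _ h with h | h | h | h <;> simp only at h <;> omega
  have c1 : (iv n i n).card = n - i := card_iv le_rfl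
  have c2 : (iv n (s + 2) (r + 1)).card = r - (s + 1) := by rw [card_iv (by omega)]; omega
  refine final_F (N := (n - i) + (r - (s + 1))) (iv n i n ∪ iv n (s + 2) (r + 1)) ?_ ?_ ?_ ?_ ?_
  · intro a b hab
    simp only [Finset.mem_union, mem_iv]
    have := a.2
    have := b.2
    rcases hed _ _ hab with h | h | h | h <;> omega
  · intro a ha
    simp only [Finset.mem_union, mem_iv] at ha
    rcases ha with ha | ha
    · refine ⟨⟨s, hsn⟩, ?_, (hed1 a ha.1).symm⟩
      simp only [Finset.mem_union, mem_iv]; omega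
    · refine ⟨⟨s + 1, hjn⟩, ?_, (hed2 a (by omega) (by omega)).symm⟩
      simp only [Finset.mem_union, mem_iv]; omega
  · rw [Finset.card_union_of_disjoint, c1, c2]
    rw [Finset.disjoint_left]
    intro x
    simp only [mem_iv]
    omega
  · refine ara_of_lev (fun a b => if a = s then b - i else (n - i) + (b - (s + 2))) _ ?_ ?_
    · intro a b hab hb h
      rw [hE _ _ hab] at h
      split_ifs <;> omega
    · intro a b a' b' hab hb h hab' hb' h' hne hl
      rw [hE _ _ hab] at h
      rw [hE _ _ hab'] at h'
      exfalso
      split_ifs at hl <;> omega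
  · have hs := ed_symm (n := n) s i (s + 1) r
    have hi := ed_irr (n := n) s i (s + 1) r
    refine EFR_split hs hi (v := ⟨s, hsn⟩) (by simp) ?_ ?_
    · rw [hn1, Finset.empty_union]
      refine EFR_split hs hi (v := ⟨s + 1, hjn⟩) (by rw [mem_iv]; simp only; omega) ?_ ?_
      · rw [hn2]
        refine EFR_cover _ ?_ ?_
        · intro a b hab
          simp only [Finset.mem_union, mem_iv]
          have := a.2
          have := b.2
          rcases hed _ _ hab with h | h | h | h <;> omega
        · refine (Finset.card_union_le _ _).trans ?_
          rw [c1, c2]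
      · refine EFR_cover _ ?_ ?_
        · intro a b hab
          simp only [Finset.mem_insert, mem_iv, Fin.ext_iff]
          have := a.2
          have := b.2
          rcases hed _ _ hab with h | h | h | h <;> omega
        · refine (Finset.card_insert_le _ _).trans ?_
          rw [c1]; omega
    · refine EFR_split hs hi (v := ⟨s + 1, hjn⟩) (by simp) ?_ ?_
      · rw [hn2]
        refine EFR_cover _ ?_ ?_
        · intro a b hab
          simp only [Finset.mem_union, Finset.mem_insert, mem_iv, Fin.ext_iff]
          have := a.2
          have := b.2
          rcases hed _ _ hab with h | h | h | h <;> omega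
        · refine (Finset.card_union_le _ _).trans ?_
          rw [c2]; simp; omega
      · refine EFR_cover _ ?_ ?_
        · intro a b hab
          simp only [Finset.mem_insert, Fin.ext_iff]
          rcases hed _ _ hab with h | h | h | h <;> omega
        · refine (Finset.card_insert_le _ _).trans ?_
          simp; omega

theorem case_big {s i j r : ℕ} (hsi : s < i) (hin : i < n) (hjr : j < r) (hrn : r < n)
    (hsj : s < j) (hc : i ≤ j ∨ (i = j + 1 ∧ r + 1 = n)) :
    araI (eI k (ed (n := n) s i j r) ∅) = pdQ (eI k (ed (n := n) s i j r) ∅) := by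
  have hs := ed_symm (n := n) s i j r
  have hi := ed_irr (n := n) s i j r
  obtain ⟨m, hm⟩ : ∃ m, n = m + s + 2 := ⟨n - s - 2, by omega⟩
  have he : ∀ a b : Fin n, ed s i j r a b → s ≤ a.1 ∧ s ≤ b.1 := by
    rintro a b (⟨h0, h1, h2⟩ | ⟨h0, h1, h2⟩) <;> omega
  have cA : (iv n s i).card = i - s := card_iv (by omega)
  have cB : (iv n i n).card = n - i := card_iv le_rfl
  have hdis : Disjoint (iv n s i) (iv n i n) := by
    rw [Finset.disjoint_left]
    intro x
    simp only [mem_iv]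
    omega
  have hAB : ∀ a ∈ iv n s i, ∀ b ∈ iv n i n, ed s i j r a b := by
    intro a ha b hb
    rw [mem_iv] at ha hb
    left
    unfold E0
    omega
  have hAB' : ∀ a b : Fin n, ed s i j r a b → a ∈ iv n s i ∪ iv n i n ∧ b ∈ iv n s i ∪ iv n i n := by
    intro a b hab
    have := he _ _ hab
    simp only [Finset.mem_union, mem_iv]
    omega
  have hcard : (iv n s i ∪ iv n i n).card = m + 2 := by
    rw [Finset.card_union_of_disjoint hdis, cA, cB]; omega
  have neA : (iv n s i).Nonempty := Finset.card_pos.1 (by omega)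
  have neB : (iv n i n).Nonempty := Finset.card_pos.1 (by omega)
  have gE : ∀ (W : Finset (Fin n)) (a b : Fin n), gen (ed s i j r) W a b →
      (a.1 < b.1 ∧ E0 s i j r a b ∧ a ∉ W ∧ b ∉ W) ∨ (a = b ∧ a ∈ W) := by
    rintro W a b (⟨h1, h2 | h2, h3, h4⟩ | h)
    · exact Or.inl ⟨h1, h2.2, h3, h4⟩
    · exact absurd h2.1 (by rw [Fin.lt_def] at h1; omega)
    · exact Or.inr h
  have aA : ARA k (ed (n := n) s i j r) (iv n s i) (m + 1) := by
    refine sv_eI hs hi _ (fun a b => if a = b then a.1 - s else b.1 - s - 1) _ ?_ ?_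
    · intro a b hab
      have := a.2
      have := b.2
      split_ifs
      · rcases gE _ _ _ hab with h | ⟨rfl, h⟩
        · omega
        · rw [mem_iv] at h; omega
      · omega
    · intro a b a' b' h h' hne hl
      rcases gE _ _ _ h with ⟨g1, g2, g3, g4⟩ | ⟨rfl, g⟩ <;>
        rcases gE _ _ _ h' with ⟨g1', g2', g3', g4'⟩ | ⟨rfl, g'⟩
      · have e1 : a ≠ b := fun hh => by rw [hh] at g1; omega
        have e2 : a' ≠ b' := fun hh => by rw [hh] at g1'; omega
        rw [if_neg e1, if_neg e2] at hl
        rw [mem_iv] at g3 g4 g3' g4'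
        have f1 : s ≤ a.1 ∧ a.1 ≤ j := by unfold E0 at g2; omega
        have f2 : s ≤ a'.1 ∧ a'.1 ≤ j := by unfold E0 at g2'; omega
        have hb : b = b' := Fin.ext (by omega)
        subst hb
        have ha : a.1 ≠ a'.1 := fun hh => hne ⟨Fin.ext hh, rfl⟩
        have key : ∀ c d : Fin n, s < c.1 → c.1 < d.1 → d.1 ≤ j → c ∉ iv n s i → d ∉ iv n s i →
            gen (ed s i j r) (iv n s i) c d := fun c d q1 q2 q3 q4 q5 =>
          Or.inl ⟨q2, Or.inl ⟨q2, Or.inl q1, Or.inl (by omega)⟩, q4, q5⟩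
        rcases Nat.lt_or_gt_of_ne ha with hlt | hlt
        · refine ⟨a, a', key a a' (by omega) hlt f2.2 (by rw [mem_iv]; omega)
            (by rw [mem_iv]; omega), ?_, by simp, by simp⟩
          rw [if_neg e1, if_neg (fun hh => by rw [hh] at hlt; omega)]
          omega
        · refine ⟨a', a, key a' a (by omega) hlt f1.2 (by rw [mem_iv]; omega)
            (by rw [mem_iv]; omega), ?_, by simp, by simp⟩
          rw [if_neg e1, if_neg (fun hh => by rw [hh] at hlt; omega)]
          omega
      · exfalso
        have e1 : a ≠ b := fun hh => by rw [hh] at g1; omega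
        rw [if_neg e1, if_pos rfl] at hl
        rw [mem_iv] at g3 g4 g'
        have f1 : s ≤ a.1 ∧ a.1 ≤ j := by unfold E0 at g2; omega
        omega
      · exfalso
        have e1 : a' ≠ b' := fun hh => by rw [hh] at g1'; omega
        rw [if_neg e1, if_pos rfl] at hl
        rw [mem_iv] at g3' g4' g
        have f1 : s ≤ a'.1 ∧ a'.1 ≤ j := by unfold E0 at g2'; omega
        omega
      · exfalso
        rw [if_pos rfl, if_pos rfl] at hl
        rw [mem_iv] at g g'
        have : a = a' := Fin.ext (by omega)
        exact hne ⟨this, this⟩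
  have aB : ARA k (ed (n := n) s i j r) (iv n i n) (m + 1) := by
    refine sv_eI hs hi _ (fun _ b => b.1 - s - 1) _ ?_ ?_
    · intro a b hab
      have := b.2
      omega
    · intro a b a' b' h h' hne hl
      rcases gE _ _ _ h with ⟨g1, g2, g3, g4⟩ | ⟨rfl, g⟩ <;>
        rcases gE _ _ _ h' with ⟨g1', g2', g3', g4'⟩ | ⟨rfl, g'⟩
      · rw [mem_iv] at g3 g4 g3' g4'
        have := b.2
        have := b'.2
        have f1 : s < a.1 ∧ a.1 ≤ j := by unfold E0 at g2; omega
        have f2 : s < a'.1 ∧ a'.1 ≤ j := by unfold E0 at g2'; omega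
        have hb : b = b' := Fin.ext (by omega)
        subst hb
        have ha : a.1 ≠ a'.1 := fun hh => hne ⟨Fin.ext hh, rfl⟩
        have key : ∀ c d : Fin n, s < c.1 → c.1 < d.1 → d.1 ≤ j → c ∉ iv n i n → d ∉ iv n i n →
            gen (ed s i j r) (iv n i n) c d := fun c d q1 q2 q3 q4 q5 =>
          Or.inl ⟨q2, Or.inl ⟨q2, Or.inl q1, Or.inl (by omega)⟩, q4, q5⟩
        rcases Nat.lt_or_gt_of_ne ha with hlt | hlt
        · refine ⟨a, a', key a a' (by omega) hlt f2.2 (by rw [mem_iv]; omega)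
            (by rw [mem_iv]; omega), ?_, by simp, by simp⟩
          omega
        · refine ⟨a', a, key a' a (by omega) hlt f1.2 (by rw [mem_iv]; omega)
            (by rw [mem_iv]; omega), ?_, by simp, by simp⟩
          omega
      · exfalso
        rw [mem_iv] at g3 g4 g'
        have := b.2
        have f1 : s ≤ a.1 := by unfold E0 at g2; omega
        omega
      · exfalso
        rw [mem_iv] at g3' g4' g
        have := b'.2
        have f1 : s ≤ a'.1 := by unfold E0 at g2'; omega
        omega
      · exfalso
        rw [mem_iv] at g g'
        have : a = a' := Fin.ext (by omega)
        exact hne ⟨this, this⟩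
  have eA : EFR k (ed (n := n) s i j r) (iv n s i) (m + 1) := by
    refine EFR_gen hs hi _ (iv n i n) _ rfl neB hdis.symm ?_ _ (by omega)
    intro a b hab
    have h := hAB' _ _ hab
    simp only [Finset.mem_union] at h
    tauto
  have eB : EFR k (ed (n := n) s i j r) (iv n i n) (m + 1) := by
    refine EFR_gen hs hi _ (iv n s i) _ rfl neA hdis ?_ _ (by omega)
    intro a b hab
    have h := hAB' _ _ hab
    simp only [Finset.mem_union] at h
    tauto
  refine final_eq (N := m + 1) ?_ ?_ ?_ ?_
  · exact ara_of_lev (lev1 n s i j) _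
      (lev1_lt hsi hjr hrn hsj _ (by omega) (by omega))
      (lev1_sv hsi hjr hrn hsj (by omega))
  · refine EFR_gen hs hi _ (iv n s n) ∅ rfl ?_ (by simp) ?_ _ ?_
    · exact ⟨⟨s, by omega⟩, by rw [mem_iv]; simp only; omega⟩
    · intro a b hab
      have := he _ _ hab
      right; right
      simp only [mem_iv]
      omega
    · rw [card_iv le_rfl]; simp; omega
  · exact fun M h => disc_bound_ARA (injRes _) hAB hAB' hcard aA aB h
  · exact fun M h => disc_bound_EFR (injRes _) hAB hAB' hcard eA eB h

theorem case_small {s i j r : ℕ} (hin : i < n) (hjr : j < r) (hrn : r < n)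
    (hsj : s < j) (hji : j < i) (h1 : ¬ (i = j + 1 ∧ r + 1 = n)) (h2 : j = s + 1 → i ≤ r + 1) :
    araI (eI k (ed (n := n) s i j r) ∅) = pdQ (eI k (ed (n := n) s i j r) ∅) := by
  have hs := ed_symm (n := n) s i j r
  have hi := ed_irr (n := n) s i j r
  obtain ⟨N, hN⟩ : ∃ N, n = N + s + 2 := ⟨n - s - 2, by omega⟩
  have he : ∀ a b : Fin n, ed s i j r a b → s ≤ a.1 ∧ s ≤ b.1 := by
    rintro a b (⟨h0, h1, h2⟩ | ⟨h0, h1, h2⟩) <;> omega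
  refine final_F (N := N) (iv n (s + 2) n) ?_ ?_ ?_ ?_ ?_
  · rintro a b (⟨h0, h1, h2⟩ | ⟨h0, h1, h2⟩) <;> simp only [mem_iv] <;> omega
  · intro a ha
    rw [mem_iv] at ha
    by_cases hc : s + 1 < j ∨ a.1 ≤ r
    · refine ⟨⟨s + 1, by omega⟩, by rw [mem_iv]; simp only; omega, Or.inr ?_⟩
      unfold E0
      simp only
      omega
    · refine ⟨⟨s, by omega⟩, by rw [mem_iv]; simp only; omega, Or.inr ?_⟩
      have hia : i ≤ a.1 := by omega
      refine ⟨by simp only; omega, Or.inr ⟨rfl, hia⟩, Or.inl hsj⟩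
  · rw [card_iv le_rfl]; omega
  · by_cases hc : r + 1 = n
    · exact ara_of_lev (lev2 n s i j) _
        (lev2_lt hin hsj (by omega) _ hN)
        (lev2_sv hin hc hsj (by omega))
    · exact ara_of_lev (lev1 n s i j) _
        (lev1_lt (by omega) hjr hrn hsj _ (by omega) (by omega))
        (lev1_sv (by omega) hjr hrn hsj (by omega))
  · have hne : ∀ a b : Fin n, ed s i j r a b → ∀ x y : Fin n, x.1 = s → y.1 < i →
        ¬ ((a = x ∧ b = y) ∨ (a = y ∧ b = x)) := by
      rintro a b (⟨h0, h1, h2⟩ | ⟨h0, h1, h2⟩) x y hx hy (⟨rfl, rfl⟩ | ⟨rfl, rfl⟩) <;> omega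
    have sn : s < n := by omega
    have c1 : Conn (ed (n := n) s i j r) {⟨s, sn⟩, ⟨s + 1, by omega⟩} := by
      refine Conn.base _ _ (by simp) ?_
      intro h
      exact hne _ _ h ⟨s, sn⟩ ⟨s + 1, by omega⟩ rfl (by simp only; omega) (by simp)
    have c2 := Conn.extend (V := iv n s (j + 1)) c1 (by
      intro v hv _
      refine ⟨⟨s, sn⟩, by simp, ?_⟩
      rw [mem_iv] at hv
      intro h
      exact hne _ _ h ⟨s, sn⟩ v rfl (by omega) (by simp))
    obtain ⟨c, hc, c3⟩ : ∃ c : Fin n, j < c.1 ∧ Conn (ed (n := n) s i j r)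
        (({⟨s, sn⟩, ⟨s + 1, by omega⟩} ∪ iv n s (j + 1)) ∪ {c}) := by
      by_cases hij : j + 2 ≤ i
      · refine ⟨⟨j + 1, by omega⟩, by simp, Conn.extend c2 ?_⟩
        intro v hv _
        rw [Finset.mem_singleton] at hv
        subst hv
        refine ⟨⟨s, sn⟩, by simp, ?_⟩
        intro h
        exact hne _ _ h ⟨s, sn⟩ ⟨j + 1, by omega⟩ rfl (by simp only; omega) (by simp)
      · refine ⟨⟨n - 1, by omega⟩, by simp only; omega, Conn.extend c2 ?_⟩
        intro v hv _
        rw [Finset.mem_singleton] at hv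
        subst hv
        refine ⟨⟨j, by omega⟩, ?_, ?_⟩
        · rw [Finset.mem_union, mem_iv]; right; simp only; omega
        · rintro (⟨h0, h1, h2⟩ | ⟨h0, h1, h2⟩) <;> simp only at h0 h1 h2 <;> omega
    have c4 := Conn.extend (V := iv n s n) c3 (by
      intro v hv hv'
      refine ⟨c, by simp, ?_⟩
      rw [mem_iv] at hv
      simp only [Finset.mem_union, mem_iv, not_or] at hv'
      rintro (⟨h0, h1, h2⟩ | ⟨h0, h1, h2⟩) <;> omega)
    refine EFR_conn hs hi c4 ∅ (by simp) ?_ _ ?_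
    · intro a b hab
      have := he _ _ hab
      right; right
      exact ⟨Finset.mem_union_right _ (mem_iv.2 ⟨this.1, a.2⟩),
        Finset.mem_union_right _ (mem_iv.2 ⟨this.2, b.2⟩)⟩
    · have hsub : ({⟨s, sn⟩, ⟨s + 1, by omega⟩} ∪ iv n s (j + 1)) ∪ {c} ∪ iv n s n ⊆ iv n s n := by
        intro x hx
        simp only [Finset.mem_union, mem_iv, Finset.mem_insert, Finset.mem_singleton,
          Fin.ext_iff] at hx
        rw [mem_iv]
        have := x.2
        omega
      have := Finset.card_le_card hsub
      rw [card_iv le_rfl] at this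
      rw [Finset.card_empty]
      omega
end Comb2

open MvPolynomial
section Trans
variable {n : ℕ}

theorem pair_sorted {u : Finset (Fin n)} (hu : u.card = 2) : ∃ a b : Fin n, a < b ∧ u = {a, b} := by
  obtain ⟨x, y, hxy, rfl⟩ := Finset.card_eq_two.1 hu
  rcases lt_or_gt_of_ne hxy with h | h
  · exact ⟨x, y, h, rfl⟩
  · exact ⟨y, x, h, Finset.pair_comm _ _⟩

theorem ge_pair {a b c d : Fin n} (hab : a < b) (hcd : c < d) :
    sqGeLex {a, b} {c, d} ↔ (a.1 < c.1 ∨ (a.1 = c.1 ∧ b.1 ≤ d.1)) := by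
  rw [Fin.lt_def] at hab hcd
  constructor
  · rintro (h | ⟨x, hx, hx', h⟩)
    · have h1 : a ∈ ({c, d} : Finset (Fin n)) := h ▸ (by simp)
      have h2 : b ∈ ({c, d} : Finset (Fin n)) := h ▸ (by simp)
      simp only [Finset.mem_insert, Finset.mem_singleton, Fin.ext_iff] at h1 h2
      omega
    · have hc := h c
      have hd := h d
      have ha := h a
      simp only [Finset.mem_insert, Finset.mem_singleton, Fin.ext_iff, Fin.lt_def,
        true_or, or_true, iff_true, true_iff] at hx hx' ha hc hd
      omega
  · intro h
    by_cases h1 : a.1 < c.1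
    · refine Or.inr ⟨a, by simp, ?_, ?_⟩
      · simp only [Finset.mem_insert, Finset.mem_singleton, Fin.ext_iff]; omega
      · intro x hx
        simp only [Finset.mem_insert, Finset.mem_singleton, Fin.ext_iff, Fin.lt_def] at hx ⊢
        omega
    have hac : a = c := Fin.ext (by omega)
    subst hac
    by_cases h2 : b = d
    · left; rw [h2]
    have h3 : b.1 ≠ d.1 := fun h => h2 (Fin.ext h)
    refine Or.inr ⟨b, by simp, ?_, ?_⟩
    · simp only [Finset.mem_insert, Finset.mem_singleton, Fin.ext_iff]; omega
    · intro x hx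
      simp only [Finset.mem_insert, Finset.mem_singleton, Fin.ext_iff, Fin.lt_def] at hx ⊢
      omega

theorem seg_iff {s i j r a b : Fin n} (hsi : s < i) (hjr : j < r) (hab : a < b) :
    ({a, b} : Finset (Fin n)) ∈ sqLexSeg 2 {s, i} {j, r} ↔ E0 s i j r a b := by
  have hc : ({a, b} : Finset (Fin n)).card = 2 := Finset.card_pair hab.ne
  simp only [sqLexSeg, Set.mem_ofPred_eq, hc, true_and, ge_pair hsi hab, ge_pair hab hjr, E0]
  omega

theorem main_thm {k : Type u} [Field k] (u v : Finset (Fin n))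
    (hu : u.card = 2) (hv : v.card = 2) (huv : sqGeLex u v) :
    araI (sqIdeal n k (sqLexSeg 2 u v)) = pdQ (sqIdeal n k (sqLexSeg 2 u v)) := by
  obtain ⟨s, i, hsi, rfl⟩ := pair_sorted hu
  obtain ⟨j, r, hjr, rfl⟩ := pair_sorted hv
  rw [ge_pair hsi hjr] at huv
  rw [gen_pair_iff (sqLexSeg 2 {s, i} {j, r}) (ed s.1 i.1 j.1 r.1) (ed_irr _ _ _ _)]
  · have hr := r.2
    have hi := i.2
    rw [Fin.lt_def] at hsi hjr
    generalize s.1 = s' at *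
    generalize i.1 = i' at *
    generalize j.1 = j' at *
    generalize r.1 = r' at *
    by_cases h1 : s' = j'
    · subst h1
      exact case_star hsi (by omega) hr
    have hsj : s' < j' := by omega
    by_cases h2 : j' = s' + 1 ∧ r' + 1 < i'
    · obtain ⟨rfl, h2⟩ := h2
      exact case_two hi hjr h2
    by_cases h3 : i' ≤ j' ∨ (i' = j' + 1 ∧ r' + 1 = n)
    · exact case_big hsi hi hjr hr hsj h3
    · exact case_small hi hjr hr hsj (by omega) (by omega) (by omega)
  · intro F hF
    obtain ⟨a, b, hab, rfl⟩ := pair_sorted hF.1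
    exact ⟨a, b, Or.inl ⟨hab, (seg_iff hsi hjr hab).1 hF⟩, rfl⟩
  · rintro a b (h | h)
    · exact (seg_iff hsi hjr h.1).2 h.2
    · rw [Finset.pair_comm a b]
      exact (seg_iff hsi hjr h.1).2 h.2
end Trans

/-- for every lexsegment edge ideal `I = (L(u,v))` (with `u ≥_lex v`
squarefree monomials of degree 2), the arithmetical rank of `I` equals the projective
dimension of `S/I`. -/
theorem stmt17 {k : Type*} [Field k] (n : ℕ) (u v : Finset (Fin n))
    (hu : u.card = 2) (hv : v.card = 2) (huv : sqGeLex u v) :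
    araI (sqIdeal n k (sqLexSeg 2 u v)) = pdQ (sqIdeal n k (sqLexSeg 2 u v)) :=
  main_thm u v hu hv huv
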